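/- arXiv:1010.3671 — 12 statements merged into one kernel-verified Lean document; each statement's English description precedes it below -/
import Mathlib

section
/- Let k be a commutative ring in which 2 is invertible, A a commutative k-algebra, I an ideal of A, and E an A-module with I·E = 0 which is faithful as a module over B = A/I. Let π : A × A → A be an antisymmetric k-bilinear map. If there exists a k-bilinear map α : A × E → E satisfying a·α(b,e) − α(ab,e) + α(a,b·e) = π(a,b)·e for all a,b ∈ A and e ∈ E, then π(x,y) ∈ I for all x,y ∈ I. -/
/-- If a k-bilinear map α : A × E → E satisfies the first-order module
equation (A.5) for an antisymmetric bilinear map π, where E is killed by I and faithful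
over B = A/I, then π(I,I) ⊆ I (the ideal I is coisotropic). -/
theorem coisotropic_of_firstOrderDeformation
    (k : Type*) [CommRing k] (A : Type*) [CommRing A] [Algebra k A]
    (h2 : IsUnit (2 : k))
    (I : Ideal A) (E : Type*) [AddCommGroup E] [Module A E]
    [Module k E] [IsScalarTower k A E]
    (hIE : ∀ x ∈ I, ∀ e : E, x • e = 0)
    (hfaithful : ∀ a : A, (∀ e : E, a • e = 0) → a ∈ I)
    (π : A →ₗ[k] A →ₗ[k] A)
    (hanti : ∀ a b : A, π a b = - π b a)
    (hα : ∃ α : A →ₗ[k] E →ₗ[k] E,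
      ∀ (a b : A) (e : E), a • α b e - α (a * b) e + α a (b • e) = π a b • e) :
    ∀ x ∈ I, ∀ y ∈ I, π x y ∈ I := by
  obtain ⟨α, hα⟩ := hα
  intro x hx y hy
  apply hfaithful
  intro e
  have h1 := hα x y e
  have h3 := hα y x e
  rw [hIE x hx, hIE y hy, map_zero, zero_sub, add_zero] at h1
  rw [hIE x hx, hIE y hy, map_zero, zero_sub, add_zero, mul_comm y x, h1, hanti y x,
    neg_smul] at h3
  have h4 : (2 : k) • (π x y • e) = 0 := by
    rw [two_smul]
    nth_rewrite 1 [h3]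
    exact neg_add_cancel _
  exact (h2.smul_eq_zero).1 h4
end

section
/- Let k be a field of characteristic zero, A a smooth commutative k-algebra (formally smooth and of finite presentation over k), I an ideal such that B = A/I is also smooth over k, and E a finitely generated projective B-module (viewed as an A-module with I·E = 0). Let π : A × A → A be an antisymmetric k-bilinear map satisfying the Hochschild cocycle identity a·π(b,c) − π(ab,c) + π(a,bc) − π(a,b)·c = 0 for all a,b,c ∈ A, and suppose π(x,y) ∈ I for all x,y ∈ I. Then there exists a k-bilinear map α : A × E → E satisfying a·α(b,e) − α(ab,e) + α(a,b·e) = π(a,b)·e for all a,b ∈ A and e ∈ E. -/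
universe u v

namespace FOMD

variable {k : Type u} [Field k] {A : Type u} [CommRing A] [Algebra k A]

/-- An antisymmetric Hochschild cocycle is a biderivation. -/
theorem leib_left [CharZero k] (π : A →ₗ[k] A →ₗ[k] A)
    (hanti : ∀ a b : A, π a b = - π b a)
    (hcocycle : ∀ a b c : A, a * π b c - π (a * b) c + π a (b * c) - π a b * c = 0)
    (a b c : A) : π (a * b) c = a * π b c + b * π a c := by
  have h1 := hcocycle a b c
  have h2 := hcocycle b c a
  have h3 := hcocycle c a b
  rw [hanti a (b * c), hanti a b] at h1
  rw [hanti b (c * a), hanti c a] at h2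
  rw [hanti c (a * b), hanti c a] at h3
  rw [hanti b c] at h2 ⊢
  rw [hanti b c] at h1
  rw [hanti a b] at h3
  have h : (2 : k) • (π (a * b) c - (a * (- π c b) + b * π a c)) = 0 := by
    rw [two_smul]
    linear_combination -h1 + h2 - h3
  rcases smul_eq_zero.1 h with h | h
  · exact absurd h two_ne_zero
  · exact sub_eq_zero.1 h

theorem connection {B : Type u} [CommRing B] [Algebra k B] {E : Type v} [AddCommGroup E]
    [Module B E] [Module.Projective B E] [Module k E] [IsScalarTower k B E]
    (X : Derivation k B B) :
    ∃ N : E →ₗ[k] E, ∀ (b : B) (e : E), N (b • e) = X b • e + b • N e := by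
  obtain ⟨s, hs⟩ := Module.Projective.out (R := B) (P := E)
  refine ⟨((Finsupp.linearCombination B (id : E → E)).restrictScalars k) ∘ₗ
    (Finsupp.mapRange.linearMap (X : B →ₗ[k] B)) ∘ₗ (s.restrictScalars k), fun b e => ?_⟩
  have key : Finsupp.mapRange.linearMap (X : B →ₗ[k] B) (b • s e)
      = X b • s e + b • Finsupp.mapRange.linearMap (X : B →ₗ[k] B) (s e) := by
    ext i
    simp
    ring
  have := hs e
  simp only [LinearMap.comp_apply, LinearMap.restrictScalars_apply, map_smul, key, map_add, this]

/-- Finite dual frame by exact differentials. -/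
theorem frame (B : Type u) [CommRing B] [Algebra k B]
    [Algebra.FormallySmooth k B] [Algebra.FinitePresentation k B] :
    ∃ (S : Finset B) (X : B → Derivation k B B), ∀ (D : Derivation k B B) (b : B),
      D b = ∑ x ∈ S, X x b * D x := by
  classical
  have hfg : (Submodule.span B (Set.range (KaehlerDifferential.D k B))).FG := by
    rw [KaehlerDifferential.span_range_derivation]
    exact Module.Finite.fg_top
  obtain ⟨T, hT, hspan⟩ := Submodule.fg_span_iff_fg_span_finset_subset _ |>.1 hfg
  rw [KaehlerDifferential.span_range_derivation] at hspan
  obtain ⟨S, hS, hST⟩ : ∃ S : Finset B, (S.image (KaehlerDifferential.D k B)) = T ∧ True := by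
    obtain ⟨S, hS⟩ := Finset.subset_set_image_iff.1 (by rwa [← Set.image_univ] at hT)
    exact ⟨S, hS.2, trivial⟩
  let v : S → Ω[B⁄k] := fun x => KaehlerDifferential.D k B x
  have hsurj : Function.Surjective (Finsupp.linearCombination B v) := by
    rw [← LinearMap.range_eq_top, Finsupp.range_linearCombination, hspan, ← hS]
    congr 1
    ext w
    simp [v]
  obtain ⟨s, hs⟩ := Module.projective_lifting_property (Finsupp.linearCombination B v)
    LinearMap.id hsurj
  refine ⟨S, fun x => if h : x ∈ S then
    (((Finsupp.lapply (⟨x, h⟩ : S)) ∘ₗ s).compDer (KaehlerDifferential.D k B)) else 0, ?_⟩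
  intro D b
  have h1 : Finsupp.linearCombination B v (s (KaehlerDifferential.D k B b))
      = KaehlerDifferential.D k B b := LinearMap.congr_fun hs _
  have h2 := congrArg D.liftKaehlerDifferential h1
  rw [Derivation.liftKaehlerDifferential_comp_D, Finsupp.linearCombination_apply,
    Finsupp.sum_fintype _ _ (by simp), map_sum] at h2
  rw [← h2, ← Finset.sum_coe_sort S]
  refine Finset.sum_congr rfl fun x _ => ?_
  simp [v]

theorem section_mod_sq (I : Ideal A) [Algebra.FormallySmooth k (A ⧸ I)] :
    ∃ σ : A ⧸ I → A, (∀ b, Ideal.Quotient.mk I (σ b) = b) ∧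
      (∀ b c, σ (b + c) - (σ b + σ c) ∈ I ^ 2) ∧
      (∀ (r : k) b, σ (r • b) - r • σ b ∈ I ^ 2) ∧
      (∀ b c, σ (b * c) - σ b * σ c ∈ I ^ 2) := by
  have hle : I ^ 2 ≤ I := Ideal.pow_le_self two_ne_zero
  let g : (A ⧸ I ^ 2) →ₐ[k] A ⧸ I := Ideal.Quotient.factorₐ k hle
  have hg : Function.Surjective g := Ideal.Quotient.factor_surjective hle
  have hn : IsNilpotent (RingHom.ker (g : (A ⧸ I ^ 2) →+* A ⧸ I)) := by
    refine ⟨2, ?_⟩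
    have : RingHom.ker (g : (A ⧸ I ^ 2) →+* A ⧸ I) = I.map (Ideal.Quotient.mk (I ^ 2)) :=
      Ideal.Quotient.factor_ker hle
    rw [this, ← Ideal.map_pow, Ideal.map_quotient_self]
    rfl
  let s := Algebra.FormallySmooth.liftOfSurjective (AlgHom.id k (A ⧸ I)) g hg hn
  have hs : ∀ b, g (s b) = b := fun b =>
    Algebra.FormallySmooth.liftOfSurjective_apply (AlgHom.id k (A ⧸ I)) g hg hn b
  choose σ hσ using fun b => Ideal.Quotient.mk_surjective (s b)
  refine ⟨σ, fun b => ?_, fun b c => ?_, fun r b => ?_, fun b c => ?_⟩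
  · have := hs b
    rw [← hσ] at this
    exact this
  · rw [← Ideal.Quotient.eq, map_add, hσ, hσ, hσ, map_add]
  · rw [← Ideal.Quotient.eq, hσ, map_smul, ← hσ]
    rfl
  · rw [← Ideal.Quotient.eq, map_mul, hσ, hσ, hσ, map_mul]

/-- Restriction of a derivation `A → A/I` along the section. -/
theorem pull (I : Ideal A) (σ : A ⧸ I → A) (h0 : ∀ b, Ideal.Quotient.mk I (σ b) = b)
    (h1 : ∀ b c, σ (b + c) - (σ b + σ c) ∈ I ^ 2)
    (h2 : ∀ (r : k) b, σ (r • b) - r • σ b ∈ I ^ 2)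
    (h3 : ∀ b c, σ (b * c) - σ b * σ c ∈ I ^ 2)
    (Y : A →ₗ[k] A ⧸ I)
    (hY : ∀ a b, Y (a * b) = Ideal.Quotient.mk I a * Y b + Ideal.Quotient.mk I b * Y a) :
    ∃ D : Derivation k (A ⧸ I) (A ⧸ I), ∀ b, D b = Y (σ b) := by
  have hz : ∀ x ∈ I ^ 2, Y x = 0 := by
    intro x hx
    rw [pow_two] at hx
    refine Submodule.mul_induction_on hx (fun m hm n hn => ?_) fun x y hx hy => ?_
    · rw [hY, Ideal.Quotient.eq_zero_iff_mem.2 hm, Ideal.Quotient.eq_zero_iff_mem.2 hn]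
      simp
    · rw [map_add, hx, hy, add_zero]
  have hz' : ∀ x y, x - y ∈ I ^ 2 → Y x = Y y := fun x y h => by
    rw [← sub_eq_zero, ← map_sub]
    exact hz _ h
  refine ⟨Derivation.mk' { toFun := fun b => Y (σ b), map_add' := ?_, map_smul' := ?_ } ?_, ?_⟩
  · intro b c
    rw [hz' _ _ (h1 b c), map_add]
  · intro r b
    rw [hz' _ _ (h2 r b), map_smul]
    rfl
  · intro b c
    change Y (σ (b * c)) = b • Y (σ c) + c • Y (σ b)
    rw [hz' _ _ (h3 b c), hY, h0, h0]
    rfl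
  · intro b
    rfl

section terms

variable (I : Ideal A) {E : Type v} [AddCommGroup E] [Module (A ⧸ I) E]
    [Module.Projective (A ⧸ I) E]
    [Module A E] [IsScalarTower A (A ⧸ I) E]
    [Module k E] [IsScalarTower k A E]

theorem mk_smul' (a : A) (e : E) : Ideal.Quotient.mk I a • e = a • e := by
  have := smul_assoc a (1 : A ⧸ I) e
  rw [one_smul] at this
  rw [← this]
  congr 1
  rw [Algebra.smul_def, mul_one]
  rfl

theorem tower' : IsScalarTower k (A ⧸ I) E := by
  refine ⟨fun r b e => ?_⟩
  obtain ⟨a, rfl⟩ := Ideal.Quotient.mk_surjective b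
  have : r • Ideal.Quotient.mk I a = Ideal.Quotient.mk I (r • a) := rfl
  rw [this, mk_smul', mk_smul', smul_assoc]

/-- `f` is a coboundary. -/
def Cob (E : Type v) [AddCommGroup E] [Module (A ⧸ I) E] [Module A E] [Module k E]
    (f : A → A → A ⧸ I) : Prop :=
  ∃ α : A →ₗ[k] E →ₗ[k] E,
      ∀ (a b : A) (e : E), a • α b e - α (a * b) e + α a (b • e) = f a b • e

theorem Cob.sum {ι : Type*} (S : Finset ι) (f : ι → A → A → A ⧸ I)
    (h : ∀ i, Cob (k := k) I E (f i)) : Cob (k := k) I E (fun a b => ∑ i ∈ S, f i a b) := by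
  choose α hα using h
  refine ⟨∑ i ∈ S, α i, fun a b e => ?_⟩
  simp only [LinearMap.sum_apply, Finset.smul_sum, ← Finset.sum_sub_distrib,
    ← Finset.sum_add_distrib, hα, Finset.sum_smul]

theorem Cob.sub {f g : A → A → A ⧸ I} (hf : Cob (k := k) I E f) (hg : Cob (k := k) I E g) :
    Cob (k := k) I E (fun a b => f a b - g a b) := by
  obtain ⟨α, hα⟩ := hf
  obtain ⟨β, hβ⟩ := hg
  refine ⟨α - β, fun a b e => ?_⟩
  rw [sub_smul, ← hα, ← hβ]
  simp only [LinearMap.sub_apply, smul_sub]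
  abel

theorem cob_right (X : Derivation k (A ⧸ I) (A ⧸ I)) (Y : A →ₗ[k] A ⧸ I)
    (hY : ∀ a b, Y (a * b) = Ideal.Quotient.mk I a * Y b + Ideal.Quotient.mk I b * Y a) :
    Cob (k := k) I E (fun a b => X (Ideal.Quotient.mk I b) * Y a) := by
  haveI : IsScalarTower k (A ⧸ I) E := tower' I
  obtain ⟨N, hN⟩ := connection (E := E) X
  refine ⟨LinearMap.mk₂ k (fun a e => Y a • N e) ?_ ?_ ?_ ?_, fun a b e => ?_⟩
  · intros; simp [add_smul]
  · intros; simp [smul_assoc]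
  · intros; simp
  · intro c m n; simp only [map_smul]; exact smul_comm _ _ _
  · simp only [LinearMap.mk₂_apply, ← mk_smul' I a, ← mk_smul' I b, hN, hY]
    module

theorem cob_left (X : Derivation k (A ⧸ I) (A ⧸ I)) (Y : A →ₗ[k] A ⧸ I)
    (hY : ∀ a b, Y (a * b) = Ideal.Quotient.mk I a * Y b + Ideal.Quotient.mk I b * Y a) :
    Cob (k := k) I E (fun a b => X (Ideal.Quotient.mk I a) * Y b) := by
  haveI : IsScalarTower k (A ⧸ I) E := tower' I
  have h : Cob (k := k) I E (fun a b => - (X (Ideal.Quotient.mk I a) * Y b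
      + X (Ideal.Quotient.mk I b) * Y a)) := by
    refine ⟨LinearMap.mk₂ k (fun a e => X (Y a) • e) ?_ ?_ ?_ ?_, fun a b e => ?_⟩
    · intros; simp [add_smul]
    · intros; simp [smul_assoc]
    · intros; simp
    · intro c m n; exact smul_comm _ _ _
    · simp only [LinearMap.mk₂_apply, ← mk_smul' I a, ← mk_smul' I b, hY, map_add,
        Derivation.leibniz, smul_eq_mul]
      module
  have h0 : Cob (k := k) I E (fun _ _ => 0) := ⟨0, by simp⟩
  have := (h0.sub I h).sub I (cob_right I X Y hY)
  convert this using 3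
  ring

end terms

end FOMD

/-- Over a field of characteristic zero, for a smooth algebra A, an ideal I
with B = A/I smooth, a finitely generated projective B-module E, and an antisymmetric
Hochschild 2-cocycle π with π(I,I) ⊆ I (I coisotropic), there exists a k-bilinear map
α : A × E → E solving the first-order module equation (A.5). -/
theorem exists_firstOrder_module_deformation
    (k : Type u) [Field k] [CharZero k]
    (A : Type u) [CommRing A] [Algebra k A]
    [Algebra.FormallySmooth k A] [Algebra.FinitePresentation k A]
    (I : Ideal A)
    [Algebra.FormallySmooth k (A ⧸ I)] [Algebra.FinitePresentation k (A ⧸ I)]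
    (E : Type v) [AddCommGroup E] [Module (A ⧸ I) E]
    [Module.Finite (A ⧸ I) E] [Module.Projective (A ⧸ I) E]
    [Module A E] [IsScalarTower A (A ⧸ I) E]
    [Module k E] [IsScalarTower k A E]
    (π : A →ₗ[k] A →ₗ[k] A)
    (hanti : ∀ a b : A, π a b = - π b a)
    (hcocycle : ∀ a b c : A, a * π b c - π (a * b) c + π a (b * c) - π a b * c = 0)
    (hcoiso : ∀ x ∈ I, ∀ y ∈ I, π x y ∈ I) :
    ∃ α : A →ₗ[k] E →ₗ[k] E,
      ∀ (a b : A) (e : E), a • α b e - α (a * b) e + α a (b • e) = π a b • e := by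
  have hl := FOMD.leib_left π hanti hcocycle
  have hr : ∀ a b c : A, π c (a * b) = a * π c b + b * π c a := by
    intro a b c
    rw [hanti c, hl, hanti c a, hanti c b]
    ring
  obtain ⟨σ, h0, h1, h2, h3⟩ := FOMD.section_mod_sq (k := k) I
  obtain ⟨S, X, hX⟩ := FOMD.frame (k := k) (A ⧸ I)
  let q : A →ₗ[k] A ⧸ I := (Ideal.Quotient.mkₐ k I).toLinearMap
  have hq : ∀ a, q a = Ideal.Quotient.mk I a := fun _ => rfl
  let Z : A ⧸ I → A →ₗ[k] A ⧸ I := fun x => q ∘ₗ π (σ x)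
  have hZ : ∀ x a b, Z x (a * b) = Ideal.Quotient.mk I a * Z x b + Ideal.Quotient.mk I b * Z x a := by
    intro x a b
    change Ideal.Quotient.mk I (π (σ x) (a * b)) = Ideal.Quotient.mk I a *
      Ideal.Quotient.mk I (π (σ x) b) + Ideal.Quotient.mk I b * Ideal.Quotient.mk I (π (σ x) a)
    rw [hr, map_add, map_mul, map_mul]
  have hG : ∀ (c : A ⧸ I) (b : A), Z c b = ∑ x ∈ S, X x c * Z x b := by
    intro c b
    obtain ⟨D, hD⟩ := FOMD.pull I σ h0 h1 h2 h3 (q ∘ₗ π.flip b) (by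
      intro a a'
      change Ideal.Quotient.mk I (π (a * a') b) = Ideal.Quotient.mk I a *
        Ideal.Quotient.mk I (π a' b) + Ideal.Quotient.mk I a' * Ideal.Quotient.mk I (π a b)
      rw [hl, map_add, map_mul, map_mul])
    have := hX D c
    simp only [hD] at this
    exact this
  choose W hW using fun x => FOMD.pull I σ h0 h1 h2 h3 (Z x) (hZ x)
  have hcob : FOMD.Cob (k := k) I E (fun a b => ∑ x ∈ S,
      ((X x (Ideal.Quotient.mk I a) * Z x b - X x (Ideal.Quotient.mk I b) * Z x a)
        - X x (Ideal.Quotient.mk I a) * ((W x : (A ⧸ I) →ₗ[k] A ⧸ I) ∘ₗ q) b)) := by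
    refine FOMD.Cob.sum I S _ fun x => ?_
    refine ((FOMD.cob_left I (X x) (Z x) (hZ x)).sub I
      (FOMD.cob_right I (X x) (Z x) (hZ x))).sub I (FOMD.cob_left I (X x) _ ?_)
    intro a b
    simp [hq]
  obtain ⟨α, hα⟩ := hcob
  refine ⟨α, fun a b e => ?_⟩
  rw [hα, ← FOMD.mk_smul' I (π a b)]
  congr 1
  simp only [Finset.sum_sub_distrib, ← hG, LinearMap.comp_apply, Derivation.coeFn_coe, hW, hq]
  have hm : ∀ a : A, a - σ (Ideal.Quotient.mk I a) ∈ I := fun a => by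
    rw [← Ideal.Quotient.eq, h0]
  have h := Ideal.Quotient.eq_zero_iff_mem.2 (hcoiso _ (hm a) _ (hm b))
  simp only [map_sub, LinearMap.sub_apply] at h
  rw [hanti a (σ _), map_neg] at h
  change Ideal.Quotient.mk I _ - Ideal.Quotient.mk I _ - Ideal.Quotient.mk I _ = _
  linear_combination -h
end

section
/- Let k be a commutative ring, A a commutative k-algebra, I an ideal, and E an A-module with I·E = 0. Let π : A × A → A be an antisymmetric k-bilinear map with π(x,y) ∈ I for all x,y ∈ I, and let α : A × E → E be a k-bilinear map satisfying a·α(b,e) − α(ab,e) + α(a,b·e) = π(a,b)·e for all a,b ∈ A, e ∈ E. Then for all x,y ∈ I, a ∈ A and e ∈ E: (i) α(xy,e) = 0; (ii) α(ax,e) = a·α(x,e) + π(x,a)·e; (iii) α(x,a·e) = a·α(x,e) + 2·π(x,a)·e. -/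
/-- Properties of a solution α of the first-order module equation (A.5):
α vanishes on I², and restricted to I it is a (1/2,1)-connection, i.e.
α(ax,e) = a·α(x,e) + π(x,a)·e and α(x,a·e) = a·α(x,e) + 2·π(x,a)·e. -/
theorem firstOrder_connection_properties
    (k : Type*) [CommRing k] (A : Type*) [CommRing A] [Algebra k A]
    (I : Ideal A) (E : Type*) [AddCommGroup E] [Module A E]
    [Module k E] [IsScalarTower k A E]
    (hIE : ∀ x ∈ I, ∀ e : E, x • e = 0)
    (π : A →ₗ[k] A →ₗ[k] A)
    (hanti : ∀ a b : A, π a b = - π b a)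
    (hcoiso : ∀ x ∈ I, ∀ y ∈ I, π x y ∈ I)
    (α : A →ₗ[k] E →ₗ[k] E)
    (hα : ∀ (a b : A) (e : E), a • α b e - α (a * b) e + α a (b • e) = π a b • e) :
    ∀ x ∈ I, ∀ y ∈ I, ∀ (a : A) (e : E),
      α (x * y) e = 0 ∧
      α (a * x) e = a • α x e + π x a • e ∧
      α x (a • e) = a • α x e + 2 • (π x a • e) := by
  intro x hx y hy a e
  have h1 := hα x y e
  rw [hIE x hx, hIE y hy, hIE _ (hcoiso x hx y hy), map_zero] at h1
  have h2 := hα a x e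
  rw [hIE x hx, map_zero, hanti a x, neg_smul] at h2
  have h3 := hα x a e
  rw [hIE x hx, mul_comm x a] at h3
  have e2 : α (a * x) e = a • α x e + π x a • e := by
    rw [← sub_eq_zero, ← sub_eq_zero.mpr h2.symm]; abel
  refine ⟨by simpa using h1, e2, ?_⟩
  rw [e2] at h3
  rw [← sub_eq_zero, ← sub_eq_zero.mpr h3]; abel
end

section
/- Let k be a commutative ring, B a commutative k-algebra, M, E, F B-modules, δ : M → Der_k(B) a B-linear map, λ, λ', μ ∈ k, and let γ_E, γ_F be (λ,μ)- and (λ',μ)-connections on E and F respectively (relative to δ). Let β : M × M → M be any k-bilinear map, and for a k-linear map γ : M → End_k(V) define its curvature c(γ)(x,y) := γ(x)∘γ(y) − γ(y)∘γ(x) − γ(β(x,y)). Let Γ : M → End_k(E ⊗_B F) be the connection determined by Γ(x)(e⊗f) = γ_E(x)(e)⊗f + e⊗γ_F(x)(f). Then for all x,y ∈ M, e ∈ E, f ∈ F: c(Γ)(x,y)(e ⊗ f) = c(γ_E)(x,y)(e) ⊗ f + e ⊗ c(γ_F)(x,y)(f). -/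
open TensorProduct

/-- The curvature of the tensor product connection Γ on E ⊗_B F (defined by
the Leibniz rule from a (λ,μ)-connection γE and a (λ',μ)-connection γF) satisfies
c(Γ)(x,y)(e⊗f) = c(γE)(x,y)(e) ⊗ f + e ⊗ c(γF)(x,y)(f). -/
theorem tensorProduct_connection_curvature
    (k : Type*) [CommRing k] (B : Type*) [CommRing B] [Algebra k B]
    (M E F : Type*) [AddCommGroup M] [AddCommGroup E] [AddCommGroup F]
    [Module B M] [Module B E] [Module B F]
    [Module k M] [IsScalarTower k B M]
    [Module k E] [IsScalarTower k B E] [SMulCommClass B k E]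
    [Module k F] [IsScalarTower k B F] [SMulCommClass B k F]
    (δ : M →ₗ[B] Derivation k B B)
    (lam lam' mu : k)
    (γE : M →ₗ[k] E →ₗ[k] E)
    (hE1 : ∀ (b : B) (x : M) (e : E), γE (b • x) e = b • γE x e + lam • (δ x b • e))
    (hE2 : ∀ (b : B) (x : M) (e : E), γE x (b • e) = b • γE x e + mu • (δ x b • e))
    (γF : M →ₗ[k] F →ₗ[k] F)
    (hF1 : ∀ (b : B) (x : M) (f : F), γF (b • x) f = b • γF x f + lam' • (δ x b • f))
    (hF2 : ∀ (b : B) (x : M) (f : F), γF x (b • f) = b • γF x f + mu • (δ x b • f))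
    (β : M →ₗ[k] M →ₗ[k] M)
    (Γ : M →ₗ[k] (E ⊗[B] F) →ₗ[k] (E ⊗[B] F))
    (hΓ : ∀ (x : M) (e : E) (f : F),
      Γ x (e ⊗ₜ[B] f) = γE x e ⊗ₜ[B] f + e ⊗ₜ[B] γF x f) :
    ∀ (x y : M) (e : E) (f : F),
      Γ x (Γ y (e ⊗ₜ[B] f)) - Γ y (Γ x (e ⊗ₜ[B] f)) - Γ (β x y) (e ⊗ₜ[B] f)
        = (γE x (γE y e) - γE y (γE x e) - γE (β x y) e) ⊗ₜ[B] f
          + e ⊗ₜ[B] (γF x (γF y f) - γF y (γF x f) - γF (β x y) f) := by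
  intro x y e f
  simp only [hΓ, map_add, TensorProduct.sub_tmul, TensorProduct.tmul_sub]
  abel
end

section
/- Let k be a commutative ring, B a commutative k-algebra, M a B-module, δ : M → Der_k(B) a B-linear map, and λ ∈ k. Let L and L' be B-modules together with a B-module isomorphism φ : L ⊗_B L' ≅ B, and let γ_L : M → End_k(L) be a (λ,1)-connection, i.e. γ_L(b·x)(l) = b·γ_L(x)(l) + λ·δ(x)(b)·l and γ_L(x)(b·l) = b·γ_L(x)(l) + δ(x)(b)·l. Then there exists a unique (−λ,1)-connection γ_{L'} : M → End_k(L') such that δ(x)(φ(l ⊗ l')) = φ(γ_L(x)(l) ⊗ l') + φ(l ⊗ γ_{L'}(x)(l')) for all x ∈ M, l ∈ L, l' ∈ L'. -/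
open TensorProduct

/-- If L is invertible with inverse L' (via a B-module isomorphism
φ : L ⊗_B L' ≅ B) and γL is a (λ,1)-connection on L, then there is a unique
(−λ,1)-connection γL' on L' satisfying the Leibniz rule for the pairing φ. -/
theorem dual_connection_exists_unique
    (k : Type*) [CommRing k] (B : Type*) [CommRing B] [Algebra k B]
    (M : Type*) [AddCommGroup M] [Module B M] [Module k M] [IsScalarTower k B M]
    (L L' : Type*) [AddCommGroup L] [AddCommGroup L']
    [Module B L] [Module B L']
    [Module k L] [IsScalarTower k B L] [SMulCommClass B k L]
    [Module k L'] [IsScalarTower k B L'] [SMulCommClass B k L']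
    (δ : M →ₗ[B] Derivation k B B)
    (lam : k)
    (φ : (L ⊗[B] L') ≃ₗ[B] B)
    (γL : M →ₗ[k] L →ₗ[k] L)
    (h1 : ∀ (b : B) (x : M) (l : L), γL (b • x) l = b • γL x l + lam • (δ x b • l))
    (h2 : ∀ (b : B) (x : M) (l : L), γL x (b • l) = b • γL x l + δ x b • l) :
    ∃! γL' : M →ₗ[k] L' →ₗ[k] L',
      (∀ (b : B) (x : M) (l' : L'),
          γL' (b • x) l' = b • γL' x l' + (-lam) • (δ x b • l')) ∧
      (∀ (b : B) (x : M) (l' : L'),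
          γL' x (b • l') = b • γL' x l' + δ x b • l') ∧
      (∀ (x : M) (l : L) (l' : L'),
          δ x (φ (l ⊗ₜ[B] l')) = φ (γL x l ⊗ₜ[B] l') + φ (l ⊗ₜ[B] γL' x l')) := by
  classical
  obtain ⟨E, hE⟩ : ∃ E : L' ≃ₗ[B] Module.Dual B L, ∀ l' l, E l' l = φ (l ⊗ₜ[B] l') :=
    ⟨Module.Invertible.linearEquivDual (TensorProduct.comm B L' L ≪≫ₗ φ), fun l' l => rfl⟩
  have sep : ∀ u v : L', (∀ l, φ (l ⊗ₜ[B] u) = φ (l ⊗ₜ[B] v)) → u = v := by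
    intro u v h
    apply E.injective
    ext l
    rw [hE, hE, h]
  have kr : ∀ (c : k) (l : L) (l' : L'), φ (l ⊗ₜ[B] (c • l')) = c • φ (l ⊗ₜ[B] l') := by
    intro c l l'
    rw [← algebraMap_smul B c l', TensorProduct.tmul_smul, map_smul, algebraMap_smul]
  have kl : ∀ (c : k) (l : L) (l' : L'), φ ((c • l) ⊗ₜ[B] l') = c • φ (l ⊗ₜ[B] l') := by
    intro c l l'
    rw [← algebraMap_smul B c l, ← TensorProduct.smul_tmul', map_smul, algebraMap_smul]
  have bl : ∀ (c : B) (l : L) (l' : L'), φ ((c • l) ⊗ₜ[B] l') = c * φ (l ⊗ₜ[B] l') := by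
    intro c l l'
    rw [← TensorProduct.smul_tmul', map_smul, smul_eq_mul]
  have br : ∀ (c : B) (l : L) (l' : L'), φ (l ⊗ₜ[B] (c • l')) = c * φ (l ⊗ₜ[B] l') := by
    intro c l l'
    rw [TensorProduct.tmul_smul, map_smul, smul_eq_mul]
  have ar : ∀ (l : L) (u v : L'), φ (l ⊗ₜ[B] (u + v)) = φ (l ⊗ₜ[B] u) + φ (l ⊗ₜ[B] v) := by
    intro l u v
    rw [TensorProduct.tmul_add, map_add]
  have al : ∀ (u v : L) (l : L'), φ ((u + v) ⊗ₜ[B] l) = φ (u ⊗ₜ[B] l) + φ (v ⊗ₜ[B] l) := by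
    intro l u v
    rw [TensorProduct.add_tmul, map_add]
  have ex : ∀ (x : M) (l' : L'), ∃ w : L', ∀ l,
      φ (l ⊗ₜ[B] w) = δ x (φ (l ⊗ₜ[B] l')) - φ (γL x l ⊗ₜ[B] l') := by
    intro x l'
    let f : Module.Dual B L :=
      { toFun := fun l => δ x (φ (l ⊗ₜ[B] l')) - φ (γL x l ⊗ₜ[B] l')
        map_add' := by
          intro a b
          simp only [al, map_add]
          ring
        map_smul' := by
          intro b l
          simp only [h2, al, bl, Derivation.leibniz, smul_eq_mul, RingHom.id_apply]
          ring }
    refine ⟨E.symm f, fun l => ?_⟩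
    rw [← hE, E.apply_symm_apply]
    rfl
  choose g hg using ex
  have dk : ∀ (c : k) (x : M), δ (c • x) = c • δ x := by
    intro c x
    rw [← algebraMap_smul B c x, map_smul, algebraMap_smul]
  refine ⟨LinearMap.mk₂ k g ?_ ?_ ?_ ?_, ⟨?_, ?_, ?_⟩, ?_⟩
  · intro x y l'
    apply sep
    intro l
    simp only [ar, hg, al, map_add, LinearMap.add_apply, Derivation.add_apply]
    ring
  · intro c x l'
    apply sep
    intro l
    simp only [kr, hg, kl, dk, map_smul, LinearMap.smul_apply, Derivation.smul_apply, smul_sub]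
  · intro x u v
    apply sep
    intro l
    simp only [ar, hg, map_add]
    ring
  · intro c x u
    apply sep
    intro l
    simp only [kr, hg, Derivation.map_smul, smul_sub]
  · intro b x l'
    apply sep
    intro l
    simp only [LinearMap.mk₂_apply, ar, kr, br, hg, h1, al, kl, bl, map_smul,
      Derivation.smul_apply, smul_eq_mul]
    rw [neg_smul]
    ring
  · intro b x l'
    apply sep
    intro l
    simp only [LinearMap.mk₂_apply, ar, br, hg, Derivation.leibniz, smul_eq_mul]
    ring
  · intro x l l'
    simp only [LinearMap.mk₂_apply, hg]
    ring
  · rintro G ⟨-, -, hG⟩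
    ext x l'
    apply sep
    intro l
    rw [LinearMap.mk₂_apply, hg, hG]
    ring
end

section
/- Let A be a commutative algebra over a commutative ring k. Let α₁ : A × A → A be an antisymmetric k-bilinear map, and let α₂ : A × A → A be a k-bilinear map satisfying a·α₂(b,c) − α₂(ab,c) + α₂(a,bc) − α₂(a,b)·c = α₁(α₁(a,b),c) − α₁(a,α₁(b,c)) for all a,b,c ∈ A. Then the antisymmetrization 𝒜(a,b) := α₂(a,b) − α₂(b,a) is a Hochschild 2-cocycle: a·𝒜(b,c) − 𝒜(ab,c) + 𝒜(a,bc) − 𝒜(a,b)·c = 0 for all a,b,c ∈ A. -/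
/-- If α₁ is antisymmetric and α₂ satisfies the second-order associativity
equation (A.2), then the antisymmetrization 𝒜(a,b) = α₂(a,b) − α₂(b,a) is a
Hochschild 2-cocycle. -/
theorem antisymmetrization_is_cocycle
    (k : Type*) [CommRing k] (A : Type*) [CommRing A] [Algebra k A]
    (α₁ α₂ : A →ₗ[k] A →ₗ[k] A)
    (hanti : ∀ a b : A, α₁ a b = - α₁ b a)
    (h2 : ∀ a b c : A,
      a * α₂ b c - α₂ (a * b) c + α₂ a (b * c) - α₂ a b * c
        = α₁ (α₁ a b) c - α₁ a (α₁ b c)) :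
    ∀ a b c : A,
      a * (α₂ b c - α₂ c b) - (α₂ (a * b) c - α₂ c (a * b))
        + (α₂ a (b * c) - α₂ (b * c) a) - (α₂ a b - α₂ b a) * c = 0 := by
  intro a b c
  have h := h2 a b c
  have h' := h2 c b a
  have e1 : α₁ c (α₁ b a) = α₁ (α₁ a b) c := by
    rw [hanti c, hanti b a, map_neg, LinearMap.neg_apply, neg_neg]
  have e2 : α₁ (α₁ c b) a = α₁ a (α₁ b c) := by
    rw [hanti _ a, hanti c b, map_neg, neg_neg]
  rw [e1, e2, mul_comm c b, mul_comm b a] at h'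
  linear_combination h + h'
end

section
/- Let k be a field of characteristic zero, A a smooth commutative k-algebra (formally smooth and of finite presentation over k), I an ideal with B = A/I smooth over k, and E a finitely generated projective B-module viewed as an A-module with I·E = 0. Let α₁ˣ : A × A → A be an antisymmetric k-bilinear Hochschild 2-cocycle (a·α₁ˣ(b,c) − α₁ˣ(ab,c) + α₁ˣ(a,bc) − α₁ˣ(a,b)·c = 0), let α₂ˣ : A × A → A satisfy a·α₂ˣ(b,c) − α₂ˣ(ab,c) + α₂ˣ(a,bc) − α₂ˣ(a,b)·c = α₁ˣ(α₁ˣ(a,b),c) − α₁ˣ(a,α₁ˣ(b,c)), and let α₁ : A × E → E be a k-bilinear map satisfying a·α₁(b,e) − α₁(ab,e) + α₁(a,b·e) = α₁ˣ(a,b)·e. Then there exists a k-bilinear map α₂ : A × E → E satisfying a·α₂(b,e) − α₂(ab,e) + α₂(a,b·e) = α₂ˣ(a,b)·e + α₁(α₁ˣ(a,b),e) − α₁(a,α₁(b,e)) for all a,b,e, if and only if for all x,y ∈ I and e ∈ E: (α₂ˣ(x,y) − α₂ˣ(y,x))·e = α₁(x,α₁(y,e)) − α₁(y,α₁(x,e))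 − 2·α₁(α₁ˣ(x,y),e). -/
universe u v
theorem aux_core_ring
    (k : Type u) [Field k]
    (A : Type u) [CommRing A] [Algebra k A] [Algebra.FormallySmooth k A]
    (I : Ideal A) [Algebra.FormallySmooth k (A ⧸ I)]
    {Y : Type*} [AddCommGroup Y] [Module A Y]
    (d : Y →ₗ[A] A) (hd : ∀ y, d y ∈ I) (hsurj : ∀ x ∈ I, ∃ y, d y = x)
    {U : Type*} [CommRing U] [Algebra A U] [Algebra k U] [IsScalarTower k A U]
    (f s : U →ₐ[A] A) (j : Y →ₗ[A] U) (p : U →ₗ[A] Y)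
    (hu : ∀ u, u = algebraMap A U (f u) + j (p u))
    (hpj : ∀ y, p (j y) = y) (hfj : ∀ y, f (j y) = 0) (hsj : ∀ y, s (j y) = d y)
    (hjj : ∀ y y', j y * j y' = j (d y • y'))
    (n : ℕ) (hn : n ≠ 0) :
    ∃ m : I → Y, (∀ x, d (m x) - x ∈ I ^ n) ∧
      (∀ x x', m (x + x') - m x - m x' ∈ (I ^ n • ⊤ : Submodule A Y)) ∧
      (∀ (a : A) x, m (a • x) - a • m x ∈ (I ^ n • ⊤ : Submodule A Y)) := by
  -- the section of `A / I ^ n → A / I`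
  have hle : I ^ n ≤ I := Ideal.pow_le_self hn
  let q : A ⧸ I ^ n →ₐ[k] A ⧸ I := Ideal.Quotient.factorₐ k hle
  have hq : Function.Surjective q := Ideal.Quotient.factor_surjective hle
  have hqn : IsNilpotent (RingHom.ker (q : A ⧸ I ^ n →+* A ⧸ I)) := by
    refine ⟨n, ?_⟩
    have : RingHom.ker (q : A ⧸ I ^ n →+* A ⧸ I) = I.map (Ideal.Quotient.mk (I ^ n)) :=
      Ideal.Quotient.factor_ker hle
    rw [this, ← Ideal.map_pow, Ideal.map_quotient_self]; rfl
  let σ : A ⧸ I →ₐ[k] A ⧸ I ^ n :=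
    Algebra.FormallySmooth.liftOfSurjective (AlgHom.id k (A ⧸ I)) q hq hqn
  have hσ : ∀ b, q (σ b) = b := fun b =>
    Algebra.FormallySmooth.liftOfSurjective_apply (AlgHom.id k (A ⧸ I)) q hq hqn b
  have hqmk : ∀ a : A, q (Ideal.Quotient.mk (I ^ n) a) = Ideal.Quotient.mk I a := fun a => rfl
  -- the quotient ring
  let J : Ideal U := (I ^ n).map (algebraMap A U)
  have hJ : ∀ g : U →ₐ[A] A, ∀ u ∈ J, g u ∈ I ^ n := by
    intro g u hu
    have : J ≤ (I ^ n).comap g := by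
      rw [Ideal.map_le_iff_le_comap]
      intro a ha
      simpa using ha
    exact this hu
  have hJp : ∀ u ∈ J, p u ∈ (I ^ n • ⊤ : Submodule A Y) := by
    intro u hu
    have h1 : u ∈ (I ^ n • ⊤ : Submodule A U) := by
      rw [Ideal.smul_top_eq_map]; exact hu
    have h2 := Submodule.mem_map_of_mem (f := p) h1
    rw [Submodule.map_smul''] at h2
    exact Submodule.smul_mono le_rfl le_top h2
  have hJa : ∀ a ∈ I ^ n, algebraMap A U a ∈ J := fun a ha => Ideal.mem_map_of_mem _ ha
  have hJj : ∀ a ∈ I ^ n, ∀ y, j (a • y) ∈ J := by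
    intro a ha y
    rw [map_smul, Algebra.smul_def]
    exact J.mul_mem_right _ (hJa a ha)
  let lft : (U →ₐ[A] A) → (U ⧸ J →ₐ[k] A ⧸ I ^ n) := fun g =>
    Ideal.Quotient.liftₐ J ((Ideal.Quotient.mkₐ k (I ^ n)).comp (g.restrictScalars k))
      (fun u hu => Ideal.Quotient.eq_zero_iff_mem.mpr (hJ g u hu))
  have hlft : ∀ g u, lft g (Ideal.Quotient.mk J u) = Ideal.Quotient.mk (I ^ n) (g u) :=
    fun g u => rfl
  let S : Subalgebra k (U ⧸ J) := σ.range.comap (lft f)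
  let G : S →ₐ[k] A ⧸ I ^ n := (lft s).comp S.val
  have hfs : ∀ u, s u = f u + d (p u) := by
    intro u
    conv_lhs => rw [hu u]
    rw [map_add, AlgHom.commutes, hsj]; rfl
  have hG : Function.Surjective G := by
    intro x
    obtain ⟨a, rfl⟩ := Ideal.Quotient.mk_surjective x
    obtain ⟨a0, ha0⟩ := Ideal.Quotient.mk_surjective (σ (Ideal.Quotient.mk I a))
    have h1 : a - a0 ∈ I := by
      rw [← Ideal.Quotient.eq, ← hqmk a0, ha0, hσ]
    obtain ⟨y, hy⟩ := hsurj _ h1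
    refine ⟨⟨Ideal.Quotient.mk J (algebraMap A U a0 + j y), ?_⟩, ?_⟩
    · refine ⟨Ideal.Quotient.mk I a, ?_⟩
      change σ _ = lft f _
      rw [hlft, map_add, AlgHom.commutes, hfj, add_zero]
      exact ha0.symm
    · change lft s (Ideal.Quotient.mk J (algebraMap A U a0 + j y)) = _
      rw [hlft, map_add, AlgHom.commutes, hsj, hy]
      simp
  -- elements of `S` over `I`
  have key : ∀ z : S, ∀ x ∈ I, G z = Ideal.Quotient.mk (I ^ n) x →
      ∃ y, (z : U ⧸ J) = Ideal.Quotient.mk J (j y) ∧ d y - x ∈ I ^ n := by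
    rintro ⟨z, b, hb⟩ x hx hz
    obtain ⟨w, rfl⟩ := Ideal.Quotient.mk_surjective z
    replace hb : σ b = Ideal.Quotient.mk (I ^ n) (f w) := hb
    replace hz : Ideal.Quotient.mk (I ^ n) (s w) = Ideal.Quotient.mk (I ^ n) x := hz
    have hz' := Ideal.Quotient.eq.mp hz
    have hfw : f w ∈ I := by
      have h1 := hle hz'
      rw [hfs] at h1
      have h2 := I.sub_mem (I.add_mem h1 hx) (hd (p w))
      simpa using h2
    have hb0 : b = 0 := by
      rw [← hσ b, hb, hqmk]
      exact Ideal.Quotient.eq_zero_iff_mem.mpr hfw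
    have hfw' : f w ∈ I ^ n := by
      rw [← Ideal.Quotient.eq_zero_iff_mem, ← hb, hb0, map_zero]
    refine ⟨p w, ?_, ?_⟩
    · change Ideal.Quotient.mk J w = _
      rw [Ideal.Quotient.eq]
      have : w - j (p w) = algebraMap A U (f w) := by
        rw [sub_eq_iff_eq_add]; exact hu w
      rw [this]; exact hJa _ hfw'
    · have h2 := (I ^ n).sub_mem hz' hfw'
      rw [hfs] at h2
      convert h2 using 1; ring
  have hGn : IsNilpotent (RingHom.ker (G : S →+* A ⧸ I ^ n)) := by
    refine ⟨2, ?_⟩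
    rw [pow_two, Ideal.zero_eq_bot, eq_bot_iff, Ideal.mul_le]
    intro z hz z' hz'
    obtain ⟨y, hy, hy1⟩ := key z 0 I.zero_mem (by rw [map_zero]; exact hz)
    obtain ⟨y', hy', hy1'⟩ := key z' 0 I.zero_mem (by rw [map_zero]; exact hz')
    rw [Ideal.mem_bot]
    apply Subtype.ext
    change (z : U ⧸ J) * z' = 0
    rw [hy, hy', ← map_mul, hjj, Ideal.Quotient.eq_zero_iff_mem]
    apply hJj
    simpa using hy1
  let lam : A →ₐ[k] S :=
    Algebra.FormallySmooth.liftOfSurjective (Ideal.Quotient.mkₐ k (I ^ n)) G hG hGn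
  have hlam : ∀ a, G (lam a) = Ideal.Quotient.mk (I ^ n) a := fun a =>
    Algebra.FormallySmooth.liftOfSurjective_apply (Ideal.Quotient.mkₐ k (I ^ n)) G hG hGn a
  have hm : ∀ x : I, ∃ y, (lam x : U ⧸ J) = Ideal.Quotient.mk J (j y) ∧ d y - x ∈ I ^ n :=
    fun x => key (lam x) x x.2 (hlam x)
  choose m hm1 hm2 using hm
  have hback : ∀ y, j y ∈ J → y ∈ (I ^ n • ⊤ : Submodule A Y) := by
    intro y hy
    have := hJp _ hy
    rwa [hpj] at this
  refine ⟨m, hm2, ?_, ?_⟩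
  · intro x x'
    apply hback
    rw [← Ideal.Quotient.eq_zero_iff_mem, map_sub, map_sub, map_sub, map_sub, ← hm1, ← hm1, ← hm1]
    simp
  · intro a x
    apply hback
    have h1 : (lam ((a • x : I) : A) : U ⧸ J) = lam a * lam x := by
      rw [← Subalgebra.coe_mul, ← map_mul]; rfl
    obtain ⟨w, hw⟩ := Ideal.Quotient.mk_surjective (lam a : U ⧸ J)
    have h2 : Ideal.Quotient.mk (I ^ n) (s w) = Ideal.Quotient.mk (I ^ n) a := by
      rw [← hlam a, ← hlft, hw]; rfl
    rw [Ideal.Quotient.eq] at h2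
    rw [← Ideal.Quotient.eq_zero_iff_mem, map_sub, map_sub, ← hm1, h1, hm1, ← hw, ← map_mul,
      ← map_sub, Ideal.Quotient.eq_zero_iff_mem]
    have h3 : w * j (m x) - j (a • m x) = j ((s w - a) • m x) := by
      conv_lhs => rw [hu w]
      rw [add_mul, hjj, ← Algebra.smul_def, ← map_smul, ← map_add, ← map_sub, hfs]
      congr 1
      module
    rw [h3]
    exact hJj _ h2 _

theorem aux_core
    (k : Type u) [Field k]
    (A : Type u) [CommRing A] [Algebra k A] [Algebra.FormallySmooth k A]
    (I : Ideal A) [Algebra.FormallySmooth k (A ⧸ I)]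
    {Y : Type*} [AddCommGroup Y] [Module A Y]
    (d : Y →ₗ[A] A) (hd : ∀ y, d y ∈ I) (hsurj : ∀ x ∈ I, ∃ y, d y = x)
    (hP : ∀ y y', d y • y' = d y' • y)
    (n : ℕ) (hn : n ≠ 0) :
    ∃ m : I → Y, (∀ x, d (m x) - x ∈ I ^ n) ∧
      (∀ x x', m (x + x') - m x - m x' ∈ (I ^ n • ⊤ : Submodule A Y)) ∧
      (∀ (a : A) x, m (a • x) - a • m x ∈ (I ^ n • ⊤ : Submodule A Y)) := by
  let _ : NonUnitalCommRing Y :=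
    { (inferInstance : AddCommGroup Y) with
      mul := fun y y' => d y • y'
      left_distrib := fun a b c => smul_add _ _ _
      right_distrib := fun a b c => by
        change d (a + b) • c = d a • c + d b • c
        rw [map_add, add_smul]
      zero_mul := fun a => by
        change d 0 • a = 0
        rw [map_zero, zero_smul]
      mul_zero := fun a => smul_zero _
      mul_assoc := fun a b c => by
        change d (d a • b) • c = d a • d b • c
        rw [map_smul, smul_eq_mul, mul_smul]
      mul_comm := fun a b => hP a b }
  have hmul : ∀ y y' : Y, y * y' = d y • y' := fun _ _ => rfl
  have : IsScalarTower A Y Y := ⟨fun a y z => by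
    simp only [smul_eq_mul, hmul, map_smul, mul_smul]⟩
  have : SMulCommClass A Y Y := ⟨fun a y z => by
    simp only [smul_eq_mul, hmul]
    rw [smul_comm]⟩
  let _ : Module k Y := Module.compHom Y (algebraMap k A)
  have : IsScalarTower k A Y := IsScalarTower.of_algebraMap_smul (fun _ _ => rfl)
  let D : Y →ₙₐ[A] A :=
    { d with
      map_zero' := map_zero d
      map_mul' := fun y y' => by
        change d (y * y') = d y * d y'
        rw [hmul, map_smul, smul_eq_mul] }
  have : IsScalarTower k A (Unitization A Y) := IsScalarTower.of_algebraMap_eq (fun _ => rfl)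
  refine aux_core_ring k A I d hd hsurj (U := Unitization A Y) (Unitization.fstHom A Y)
    (Unitization.lift D) (Unitization.inrHom A A Y) (Unitization.sndHom A A Y) ?_ ?_ ?_ ?_ ?_ n hn
  · intro w
    exact (Unitization.inl_fst_add_inr_snd_eq w).symm
  · intro y; simp
  · intro y; simp
  · intro y
    change Unitization.lift D (y : Unitization A Y) = D y
    simp
  · intro y y'
    change (y : Unitization A Y) * (y' : Unitization A Y) = ((d y • y' : Y) : Unitization A Y)
    rw [← Unitization.inr_mul, hmul]

theorem aux_retract
    (k : Type u) [Field k]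
    (A : Type u) [CommRing A] [Algebra k A] [Algebra.FormallySmooth k A] [IsNoetherianRing A]
    (I : Ideal A) [Algebra.FormallySmooth k (A ⧸ I)]
    {Y : Type*} [AddCommGroup Y] [Module A Y] [Module.Finite A Y]
    (d : Y →ₗ[A] A) (hd : ∀ y, d y ∈ I) (hsurj : ∀ x ∈ I, ∃ y, d y = x)
    (hP : ∀ y y', d y • y' = d y' • y)
    {E : Type*} [AddCommGroup E] [Module A E]
    (i : E →ₗ[A] Y) (hi : Function.Injective i) (hdi : ∀ e, d (i e) = 0)
    (hex : ∀ y, d y = 0 → ∃ e, i e = y) :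
    ∃ r : Y →ₗ[A] E, ∀ e, r (i e) = e := by
  -- replacing a lift by another one does not matter after multiplying by `I`
  have hswap : ∀ (n : ℕ) (x : A) (y y' : Y), x ∈ I → d y' - d y ∈ I ^ n →
      x • y' - x • y ∈ (I ^ n • ⊤ : Submodule A Y) := by
    intro n x y y' hx h
    obtain ⟨t, rfl⟩ := hsurj x hx
    rw [← smul_sub, hP, map_sub]
    exact Submodule.smul_mem_smul h trivial
  have hzero : ∀ y, d y = 0 → y ∈ (I • ⊤ : Submodule A Y) → y = 0 := by
    intro y hy hyI
    have hall : y ∈ (⨅ n : ℕ, I ^ n • ⊤ : Submodule A Y) := by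
      rw [Submodule.mem_iInf]
      intro n
      rcases Nat.eq_zero_or_pos n with rfl | hn
      · simp
      obtain ⟨m, hm1, hm2, hm3⟩ := aux_core k A I d hd hsurj hP n hn.ne'
      have h1 : ∀ w ∈ (I • ⊤ : Submodule A Y),
          m ⟨d w, hd w⟩ - w ∈ (I ^ n • ⊤ : Submodule A Y) := by
        intro w hw
        induction hw using Submodule.smul_induction_on' with
        | smul x hx z _ =>
          have e1 : (⟨d (x • z), hd (x • z)⟩ : I) = x • ⟨d z, hd z⟩ := by
            apply Subtype.ext; simp
          rw [e1]
          have h2 := hm3 x ⟨d z, hd z⟩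
          have h3 := hswap n x z (m ⟨d z, hd z⟩) hx (hm1 ⟨d z, hd z⟩)
          simpa using Submodule.add_mem _ h2 h3
        | add w1 _ w2 _ h1 h2 =>
          have e1 : (⟨d (w1 + w2), hd (w1 + w2)⟩ : I) = ⟨d w1, hd w1⟩ + ⟨d w2, hd w2⟩ := by
            apply Subtype.ext; simp
          rw [e1]
          have h3 := Submodule.add_mem _ (Submodule.add_mem _ h1 h2)
            (hm2 ⟨d w1, hd w1⟩ ⟨d w2, hd w2⟩)
          convert h3 using 1
          abel
      have h2 := h1 y hyI
      have e0 : (⟨d y, hd y⟩ : I) = 0 := by apply Subtype.ext; simpa using hy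
      rw [e0] at h2
      have h3 : m 0 ∈ (I ^ n • ⊤ : Submodule A Y) := by
        have := hm2 0 0
        simpa using this
      have h4 := Submodule.sub_mem _ h3 h2
      simpa using h4
    obtain ⟨⟨x, hx⟩, hxy⟩ := (I.mem_iInf_smul_pow_eq_bot_iff y).mp hall
    obtain ⟨t, rfl⟩ := hsurj x hx
    rw [← hxy]
    change d t • y = 0
    rw [hP, hy, zero_smul]
  obtain ⟨m, hm1, hm2, hm3⟩ := aux_core k A I d hd hsurj hP 2 two_ne_zero
  have hle : (I ^ 2 • ⊤ : Submodule A Y) ≤ I • ⊤ :=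
    Submodule.smul_mono (Ideal.pow_le_self two_ne_zero) le_rfl
  have hsq : ∀ x ∈ I ^ 2, ∃ w ∈ (I • ⊤ : Submodule A Y), d w = x := by
    intro x hx
    have : I ^ 2 ≤ (I • ⊤ : Submodule A Y).map d := by
      rw [pow_two, Ideal.mul_le]
      intro a ha b hb
      obtain ⟨t, rfl⟩ := hsurj b hb
      exact ⟨a • t, Submodule.smul_mem_smul ha trivial, by simp⟩
    exact this hx
  have hr : ∀ y, ∃ e, y - m ⟨d y, hd y⟩ - i e ∈ (I • ⊤ : Submodule A Y) := by
    intro y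
    obtain ⟨w, hw, hw'⟩ := hsq _ (hm1 ⟨d y, hd y⟩)
    obtain ⟨e, he⟩ := hex (y - m ⟨d y, hd y⟩ + w) (by rw [map_add, map_sub, hw']; simp)
    refine ⟨e, ?_⟩
    rw [he]
    simpa using hw
  have huniq : ∀ e, i e ∈ (I • ⊤ : Submodule A Y) → e = 0 := by
    intro e he
    apply hi
    rw [map_zero]
    exact hzero _ (hdi e) he
  choose r hr using hr
  refine ⟨{ toFun := r, map_add' := ?_, map_smul' := ?_ }, ?_⟩
  · intro y z
    rw [← sub_eq_zero]
    apply huniq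
    have e1 : (⟨d (y + z), hd (y + z)⟩ : I) = ⟨d y, hd y⟩ + ⟨d z, hd z⟩ := by
      apply Subtype.ext; simp
    have h0 := hr (y + z)
    rw [e1] at h0
    have h1 := Submodule.sub_mem _ (Submodule.sub_mem _ (Submodule.add_mem _ (hr y) (hr z)) h0)
      (hle (hm2 ⟨d y, hd y⟩ ⟨d z, hd z⟩))
    convert h1 using 1
    rw [map_sub, map_add]
    abel
  · intro a y
    rw [RingHom.id_apply, ← sub_eq_zero]
    apply huniq
    have e1 : (⟨d (a • y), hd (a • y)⟩ : I) = a • ⟨d y, hd y⟩ := by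
      apply Subtype.ext; simp
    have h0 := hr (a • y)
    rw [e1] at h0
    have h1 := Submodule.sub_mem _ (Submodule.sub_mem _ (Submodule.smul_mem _ a (hr y)) h0)
      (hle (hm3 a ⟨d y, hd y⟩))
    convert h1 using 1
    rw [map_sub, map_smul]
    module
  · intro e
    change r (i e) = e
    rw [← sub_eq_zero]
    apply huniq
    have e0 : (⟨d (i e), hd (i e)⟩ : I) = 0 := by apply Subtype.ext; simpa using hdi e
    have h3 : m 0 ∈ (I • ⊤ : Submodule A Y) := by
      have := hle (hm2 0 0)
      simpa using this
    have h0 := hr (i e)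
    rw [e0] at h0
    have h1 := Submodule.neg_mem _ (Submodule.add_mem _ h0 h3)
    convert h1 using 1
    rw [map_sub]
    abel

/-- Underlying type of the extension of `I` by `E` twisted by a cocycle. -/
def AuxTw {A : Type u} [CommRing A] (I : Ideal A) (E : Type v) : Type (max u v) := E × I

theorem aux_u
    (k : Type u) [Field k]
    (A : Type u) [CommRing A] [Algebra k A] [Algebra.FormallySmooth k A] [IsNoetherianRing A]
    (I : Ideal A) [Algebra.FormallySmooth k (A ⧸ I)]
    (E : Type v) [AddCommGroup E] [Module A E] [Module.Finite A E] [Module k E]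
    [IsScalarTower k A E] (hIE : ∀ x ∈ I, ∀ e : E, x • e = 0)
    (g : A →ₗ[k] A →ₗ[k] E)
    (hg : ∀ a b, ∀ y ∈ I, a • g b y - g (a * b) y + g a (b * y) = 0)
    (hsym : ∀ x ∈ I, ∀ y ∈ I, g x y = g y x) :
    ∃ w : A →ₗ[k] E, ∀ a, ∀ y ∈ I, a • w y - w (a * y) = g a y := by
  have hg1 : ∀ y ∈ I, g 1 y = 0 := by
    intro y hy
    simpa using hg 1 1 y hy
  let _ : AddCommGroup (AuxTw I E) := inferInstanceAs (AddCommGroup (E × I))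
  let _ : Module A (AuxTw I E) :=
    { smul := fun a t => (a • t.1 + g a t.2, a • t.2)
      one_smul := fun t => Prod.ext
        (by change (1 : A) • t.1 + g 1 t.2 = t.1; rw [hg1 _ t.2.2, one_smul, add_zero])
        (one_smul A t.2)
      mul_smul := fun a b t => Prod.ext
        (by
          change (a * b) • t.1 + g (a * b) t.2 = a • (b • t.1 + g b t.2) + g a ((b • t.2 : I) : A)
          have := hg a b t.2 t.2.2
          rw [Submodule.coe_smul, smul_eq_mul]
          linear_combination (norm := module) - this)
        (mul_smul a b t.2)
      smul_zero := fun a => Prod.ext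
        (by change a • (0 : E) + g a ((0 : I) : A) = 0; simp)
        (smul_zero a)
      smul_add := fun a s t => Prod.ext
        (by
          change a • (s.1 + t.1) + g a ((s.2 + t.2 : I) : A)
            = (a • s.1 + g a s.2) + (a • t.1 + g a t.2)
          rw [Submodule.coe_add, map_add]; module)
        (smul_add a s.2 t.2)
      add_smul := fun a b t => Prod.ext
        (by
          change (a + b) • t.1 + g (a + b) t.2 = (a • t.1 + g a t.2) + (b • t.1 + g b t.2)
          rw [map_add, LinearMap.add_apply]; module)
        (add_smul a b t.2)
      zero_smul := fun t => Prod.ext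
        (by change (0 : A) • t.1 + g 0 t.2 = 0; simp)
        (zero_smul A t.2) }
  have hsm : ∀ (a : A) (e : E) (y : I),
      a • (show AuxTw I E from (e, y)) = (show AuxTw I E from (a • e + g a y, a • y)) :=
    fun _ _ _ => rfl
  let d : AuxTw I E →ₗ[A] A :=
    { toFun := fun t => (t.2 : A)
      map_add' := fun s t => rfl
      map_smul' := fun a t => rfl }
  let i : E →ₗ[A] AuxTw I E :=
    { toFun := fun e => (e, (0 : I))
      map_add' := fun e e' => Prod.ext rfl (add_zero (0 : I)).symm
      map_smul' := fun a e => Prod.ext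
        (by change a • e = a • e + g a ((0 : I) : A); simp)
        (smul_zero a).symm }
  have hi : Function.Injective i := fun e e' h => congrArg Prod.fst h
  have hex : ∀ t, d t = 0 → ∃ e, i e = t := fun t ht =>
    ⟨t.1, Prod.ext rfl (Subtype.ext ht.symm)⟩
  have hnoe : IsNoetherian A (AuxTw I E) := by
    refine isNoetherian_of_range_eq_ker i d ?_
    ext t
    constructor
    · rintro ⟨e, rfl⟩; rfl
    · intro ht; exact hex t ht
  obtain ⟨r, hr⟩ := aux_retract k A I d (fun t => t.2.2)
    (fun x hx => ⟨((0 : E), (⟨x, hx⟩ : I)), rfl⟩)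
    (fun s t => Prod.ext
      (by
        change (s.2 : A) • t.1 + g s.2 t.2 = (t.2 : A) • s.1 + g t.2 s.2
        rw [hIE _ s.2.2, hIE _ t.2.2, hsym _ s.2.2 _ t.2.2])
      (Subtype.ext (mul_comm (s.2 : A) t.2)))
    i hi (fun e => rfl) hex
  let σ : I → AuxTw I E := fun y => ((0 : E), y)
  have hσ : ∀ (a : A) (y : I), a • σ y = i (g a y) + σ (a • y) := by
    intro a y
    refine Prod.ext ?_ ?_
    · change a • (0 : E) + g a y = g a y + 0
      simp
    · change a • y = 0 + a • y
      simp
  have hrσ : ∀ (a : A) (y : I), a • r (σ y) = g a y + r (σ (a • y)) := by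
    intro a y
    rw [← map_smul, hσ, map_add, hr]
  let w0 : I.restrictScalars k →ₗ[k] E :=
    { toFun := fun y => r (σ y)
      map_add' := fun y z => by
        rw [← map_add]
        congr 1
        exact Prod.ext (add_zero (0 : E)).symm rfl
      map_smul' := fun c y => by
        have h := hrσ (algebraMap k A c) y
        have h2 : g (algebraMap k A c) (y : A) = 0 := by
          rw [Algebra.algebraMap_eq_smul_one, map_smul, LinearMap.smul_apply, hg1 _ y.2, smul_zero]
        rw [h2, zero_add, algebraMap_smul] at h
        rw [RingHom.id_apply, h]
        congr 2
        apply Subtype.ext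
        change c • (y : A) = algebraMap k A c * y
        rw [Algebra.smul_def] }
  obtain ⟨w, hw⟩ := w0.exists_extend
  refine ⟨w, fun a y hy => ?_⟩
  have h1 : ∀ y : I, w y = r (σ y) := fun y => LinearMap.congr_fun hw (⟨y, y.2⟩ : I.restrictScalars k)
  have h2 := hrσ a ⟨y, hy⟩
  rw [← h1, ← h1] at h2
  rw [sub_eq_iff_eq_add]
  exact h2

theorem aux_cocycle
    (k : Type u) [Field k]
    (A : Type u) [CommRing A] [Algebra k A]
    [Algebra.FormallySmooth k A] [Algebra.FinitePresentation k A]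
    (I : Ideal A) [Algebra.FormallySmooth k (A ⧸ I)]
    (E : Type v) [AddCommGroup E] [Module (A ⧸ I) E]
    [Module.Finite (A ⧸ I) E] [Module.Projective (A ⧸ I) E]
    [Module A E] [IsScalarTower A (A ⧸ I) E]
    [Module k E] [IsScalarTower k A E]
    (G : A →ₗ[k] A →ₗ[k] E →ₗ[k] E)
    (hG : ∀ a b c e, a • G b c e - G (a * b) c e + G a (b * c) e - G a b (c • e) = 0)
    (hsym : ∀ x ∈ I, ∀ y ∈ I, ∀ e, G x y e = G y x e) :
    ∃ α₂ : A →ₗ[k] E →ₗ[k] E, ∀ (a b : A) (e : E),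
      a • α₂ b e - α₂ (a * b) e + α₂ a (b • e) = G a b e := by
  have hmk : ∀ (a : A) (e : E), Ideal.Quotient.mk I a • e = a • e := fun a e =>
    algebraMap_smul (A ⧸ I) a e
  have hIE : ∀ x ∈ I, ∀ e : E, x • e = 0 := by
    intro x hx e
    rw [← hmk, Ideal.Quotient.eq_zero_iff_mem.mpr hx, zero_smul]
  have : IsNoetherianRing A := Algebra.FiniteType.isNoetherianRing k A
  have : Module.Finite A E := Module.Finite.trans (A ⧸ I) E
  have : IsScalarTower k (A ⧸ I) E := IsScalarTower.of_algebraMap_smul (fun c e => by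
    rw [IsScalarTower.algebraMap_apply k A (A ⧸ I), algebraMap_smul, algebraMap_smul])
  -- dual basis
  obtain ⟨n, p, hp⟩ := Module.Finite.exists_fin' (A ⧸ I) E
  obtain ⟨s, hs⟩ := Module.projective_lifting_property p LinearMap.id hp
  obtain ⟨τ, hτ⟩ := (Ideal.Quotient.mkₐ k I).toLinearMap.exists_rightInverse_of_surjective
    (LinearMap.range_eq_top.mpr Ideal.Quotient.mk_surjective)
  have hτ' : ∀ b, Ideal.Quotient.mk I (τ b) = b := fun b => LinearMap.congr_fun hτ b
  let F : Fin n → E →ₗ[k] A := fun j => τ ∘ₗ (LinearMap.proj j ∘ₗ s.restrictScalars k)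
  have hFmk : ∀ j e, Ideal.Quotient.mk I (F j e) = s e j := fun j e => hτ' _
  let v : Fin n → E := fun j => p (Pi.single j 1)
  have hF1 : ∀ e, ∑ j, F j e • v j = e := by
    intro e
    have h1 : p (s e) = e := LinearMap.congr_fun hs e
    conv_rhs => rw [← h1, LinearMap.pi_apply_eq_sum_univ p (s e)]
    refine Finset.sum_congr rfl fun j _ => ?_
    rw [← hmk, hFmk]
    congr 1
    refine congrArg p (funext fun l => ?_)
    simp [Pi.single_apply, eq_comm]
  have hF2 : ∀ j (b : A) e, F j (b • e) - b * F j e ∈ I := by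
    intro j b e
    rw [← Ideal.Quotient.eq, map_mul, hFmk, hFmk, ← hmk, map_smul]
    rfl
  -- the first correction
  have hw : ∀ j, ∃ w : A →ₗ[k] E, ∀ a, ∀ y ∈ I, a • w y - w (a * y) = G a y (v j) := by
    intro j
    refine aux_u k A I E hIE (G.compr₂ (LinearMap.applyₗ (v j))) ?_ ?_
    · intro a b y hy
      have := hG a b y (v j)
      rw [hIE y hy, map_zero, sub_zero] at this
      exact this
    · intro x hx y hy
      exact hsym x hx y hy (v j)
  choose w hw using hw
  let β : A →ₗ[k] E →ₗ[k] E := LinearMap.mk₂ k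
    (fun a e => ∑ j, (w j (a * F j e) + G a (F j e) (v j)))
    (fun a a' e => by
      simp only [add_mul, map_add, LinearMap.add_apply, ← Finset.sum_add_distrib]
      exact Finset.sum_congr rfl fun j _ => by abel)
    (fun c a e => by
      simp only [smul_mul_assoc, map_smul, LinearMap.smul_apply, Finset.smul_sum, smul_add])
    (fun a e e' => by
      simp only [mul_add, map_add, LinearMap.add_apply, ← Finset.sum_add_distrib]
      exact Finset.sum_congr rfl fun j _ => by abel)
    (fun c a e => by
      simp only [mul_smul_comm, map_smul, LinearMap.smul_apply, Finset.smul_sum, smul_add])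
  have hβ : ∀ a e, β a e = ∑ j, (w j (a * F j e) + G a (F j e) (v j)) := fun a e => rfl
  have hGF : ∀ a b e, ∑ j, G a b (F j e • v j) = G a b e := by
    intro a b e
    rw [← map_sum, hF1]
  have hβI : ∀ a, ∀ y ∈ I, ∀ e, a • β y e - β (a * y) e = G a y e := by
    intro a y hy e
    rw [hβ, hβ, ← hGF a y e, Finset.smul_sum, ← Finset.sum_sub_distrib]
    refine Finset.sum_congr rfl fun j _ => ?_
    have h1 := hw j a (y * F j e) (I.mul_mem_right _ hy)
    have h2 := hG a y (F j e) (v j)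
    rw [← mul_assoc] at h1
    linear_combination (norm := module) h1 + h2
  -- the corrected cocycle
  let H : A → A → E → E := fun a b e => G a b e - (a • β b e - β (a * b) e + β a (b • e))
  have hH : ∀ a b e, H a b e = G a b e - (a • β b e - β (a * b) e + β a (b • e)) :=
    fun _ _ _ => rfl
  have hHc : ∀ a b c e, a • H b c e - H (a * b) c e + H a (b * c) e = H a b (c • e) := by
    intro a b c e
    simp only [hH]
    have := hG a b c e
    rw [← mul_assoc, mul_smul b c e]
    linear_combination (norm := module) this
  have hHI : ∀ a, ∀ y ∈ I, ∀ e, H a y e = 0 := by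
    intro a y hy e
    rw [hH, hIE y hy, map_zero, add_zero, hβI a y hy, sub_self]
  have hHadd2 : ∀ a b b' e, H a (b + b') e = H a b e + H a b' e := by
    intro a b b' e
    simp only [hH, map_add, LinearMap.add_apply, mul_add, add_smul, smul_add]
    abel
  have hHsmul2 : ∀ (c : k) a b e, H a (c • b) e = c • H a b e := by
    intro c a b e
    simp only [hH, map_smul, LinearMap.smul_apply, mul_smul_comm, smul_assoc, smul_sub, smul_add]
    rw [smul_comm a c]
  have hHadd1 : ∀ a a' b e, H (a + a') b e = H a b e + H a' b e := by
    intro a b b' e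
    simp only [hH, map_add, LinearMap.add_apply, add_mul, add_smul]
    abel
  have hHsmul1 : ∀ (c : k) a b e, H (c • a) b e = c • H a b e := by
    intro c a b e
    simp only [hH, map_smul, LinearMap.smul_apply, smul_mul_assoc, smul_assoc, smul_sub, smul_add]
  have hHadd3 : ∀ a b e e', H a b (e + e') = H a b e + H a b e' := by
    intro a b e e'
    simp only [hH, map_add, smul_add]
    abel
  have hHsum3 : ∀ a b e, ∑ j, H a b (F j e • v j) = H a b e := by
    intro a b e
    have h := map_sum (AddMonoidHom.mk' (H a b) (hHadd3 a b)) (fun j => F j e • v j) Finset.univ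
    rw [hF1] at h
    exact h.symm
  have hHF : ∀ a b e j, H a (F j (b • e)) (v j) = H a (b * F j e) (v j) := by
    intro a b e j
    have h := hHI a _ (hF2 j b e) (v j)
    have h2 := hHadd2 a (F j (b • e) - b * F j e) (b * F j e) (v j)
    rw [h, zero_add, sub_add_cancel] at h2
    exact h2
  let γ : A →ₗ[k] E →ₗ[k] E := LinearMap.mk₂ k
    (fun a e => ∑ j, H a (F j e) (v j))
    (fun a a' e => by simp only [hHadd1, Finset.sum_add_distrib])
    (fun c a e => by simp only [hHsmul1, Finset.smul_sum])
    (fun a e e' => by simp only [map_add, hHadd2, Finset.sum_add_distrib])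
    (fun c a e => by simp only [map_smul, hHsmul2, Finset.smul_sum])
  have hγ : ∀ a e, γ a e = ∑ j, H a (F j e) (v j) := fun a e => rfl
  have hγH : ∀ a b e, a • γ b e - γ (a * b) e + γ a (b • e) = H a b e := by
    intro a b e
    rw [hγ, hγ, hγ, ← hHsum3 a b e, Finset.smul_sum, ← Finset.sum_sub_distrib,
      ← Finset.sum_add_distrib]
    refine Finset.sum_congr rfl fun j _ => ?_
    rw [hHF, hHc]
  refine ⟨β + γ, fun a b e => ?_⟩
  have h1 := hγH a b e
  rw [hH] at h1
  simp only [LinearMap.add_apply]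
  linear_combination (norm := module) h1

/-- In the smooth affine setting, a solution α₁ of the first-order module
equation extends to a solution α₂ of the second-order module equation (A.6) if and only
if the curvature condition holds on I: (α₂ˣ(x,y) − α₂ˣ(y,x))·e = α₁(x,α₁(y,e)) −
α₁(y,α₁(x,e)) − 2·α₁(α₁ˣ(x,y),e) for all x,y ∈ I. -/
theorem secondOrder_module_deformation_iff
    (k : Type u) [Field k] [CharZero k]
    (A : Type u) [CommRing A] [Algebra k A]
    [Algebra.FormallySmooth k A] [Algebra.FinitePresentation k A]
    (I : Ideal A)
    [Algebra.FormallySmooth k (A ⧸ I)] [Algebra.FinitePresentation k (A ⧸ I)]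
    (E : Type v) [AddCommGroup E] [Module (A ⧸ I) E]
    [Module.Finite (A ⧸ I) E] [Module.Projective (A ⧸ I) E]
    [Module A E] [IsScalarTower A (A ⧸ I) E]
    [Module k E] [IsScalarTower k A E]
    (αX₁ αX₂ : A →ₗ[k] A →ₗ[k] A)
    (hanti : ∀ a b : A, αX₁ a b = - αX₁ b a)
    (hX1 : ∀ a b c : A, a * αX₁ b c - αX₁ (a * b) c + αX₁ a (b * c) - αX₁ a b * c = 0)
    (hX2 : ∀ a b c : A,
      a * αX₂ b c - αX₂ (a * b) c + αX₂ a (b * c) - αX₂ a b * c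
        = αX₁ (αX₁ a b) c - αX₁ a (αX₁ b c))
    (α₁ : A →ₗ[k] E →ₗ[k] E)
    (h1 : ∀ (a b : A) (e : E),
      a • α₁ b e - α₁ (a * b) e + α₁ a (b • e) = αX₁ a b • e) :
    (∃ α₂ : A →ₗ[k] E →ₗ[k] E,
      ∀ (a b : A) (e : E),
        a • α₂ b e - α₂ (a * b) e + α₂ a (b • e)
          = αX₂ a b • e + α₁ (αX₁ a b) e - α₁ a (α₁ b e)) ↔
    (∀ x ∈ I, ∀ y ∈ I, ∀ e : E,
      (αX₂ x y - αX₂ y x) • e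
        = α₁ x (α₁ y e) - α₁ y (α₁ x e) - 2 • α₁ (αX₁ x y) e) := by
  have hmk : ∀ (a : A) (e : E), Ideal.Quotient.mk I a • e = a • e := fun a e =>
    algebraMap_smul (A ⧸ I) a e
  have hIE : ∀ x ∈ I, ∀ e : E, x • e = 0 := by
    intro x hx e
    rw [← hmk, Ideal.Quotient.eq_zero_iff_mem.mpr hx, zero_smul]
  constructor
  · rintro ⟨α₂, h2⟩ x hx y hy e
    have e1 := h2 x y e
    have e2 := h2 y x e
    rw [hIE x hx, hIE y hy, map_zero, mul_comm x y] at e1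
    rw [hIE x hx, hIE y hy, map_zero, hanti y x, map_neg, LinearMap.neg_apply] at e2
    linear_combination (norm := module) e2 - e1
  · intro hcurv
    let G : A →ₗ[k] A →ₗ[k] E →ₗ[k] E :=
      αX₂.compr₂ (Algebra.lsmul k k E).toLinearMap + αX₁.compr₂ α₁
        - (LinearMap.mul k (Module.End k E)).compl₁₂ α₁ α₁
    have hGdef : ∀ a b e, G a b e = αX₂ a b • e + α₁ (αX₁ a b) e - α₁ a (α₁ b e) :=
      fun _ _ _ => rfl
    refine aux_cocycle k A I E G ?_ ?_
    · intro a b c e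
      simp only [hGdef]
      have q1 := congrArg (fun t : A => t • e) (hX2 a b c)
      have q2 := congrArg (fun t : A => α₁ t e) (hX1 a b c)
      have q3 := h1 a (αX₁ b c) e
      have q4 := h1 (αX₁ a b) c e
      have q5 := h1 a b (α₁ c e)
      have q6 := congrArg (fun t : E => α₁ a t) (h1 b c e)
      simp only [map_add, map_sub, map_zero, LinearMap.add_apply, LinearMap.sub_apply,
        LinearMap.zero_apply, add_smul, sub_smul] at q1 q2 q6
      linear_combination (norm := module) q1 + q2 + q3 - q4 - q5 + q6
    · intro x hx y hy e
      have h := hcurv x hx y hy e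
      rw [hGdef, hGdef, hanti y x, map_neg, LinearMap.neg_apply]
      linear_combination (norm := module) h
end

section
/- Let k be a commutative ring, A a commutative k-algebra, and E an A-module. Let α₁ˣ : A × A → A be a k-bilinear Hochschild 2-cocycle (a·α₁ˣ(b,c) − α₁ˣ(ab,c) + α₁ˣ(a,bc) − α₁ˣ(a,b)·c = 0), let α₂ˣ : A × A → A satisfy a·α₂ˣ(b,c) − α₂ˣ(ab,c) + α₂ˣ(a,bc) − α₂ˣ(a,b)·c = α₁ˣ(α₁ˣ(a,b),c) − α₁ˣ(a,α₁ˣ(b,c)), and let α₁ : A × E → E be k-bilinear with a·α₁(b,e) − α₁(ab,e) + α₁(a,b·e) = α₁ˣ(a,b)·e. Then the map G(a,b,e) := α₂ˣ(a,b)·e + α₁(α₁ˣ(a,b),e) − α₁(a,α₁(b,e)) satisfies the Hochschild cocycle identity a·G(b,c,e) − G(ab,c,e) + G(a,bc,e) − G(a,b,c·e) = 0 for all a,b,c ∈ A and e ∈ E. -/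
/-- The right-hand side G(a,b,e) = α₂ˣ(a,b)·e + α₁(α₁ˣ(a,b),e) −
α₁(a,α₁(b,e)) of the second-order module equation is a Hochschild cocycle in the
complex Hom_k(A⊗A⊗E, E). -/
theorem secondOrder_rhs_is_cocycle
    (k : Type*) [CommRing k] (A : Type*) [CommRing A] [Algebra k A]
    (E : Type*) [AddCommGroup E] [Module A E]
    [Module k E] [IsScalarTower k A E]
    (αX₁ αX₂ : A →ₗ[k] A →ₗ[k] A)
    (hX1 : ∀ a b c : A, a * αX₁ b c - αX₁ (a * b) c + αX₁ a (b * c) - αX₁ a b * c = 0)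
    (hX2 : ∀ a b c : A,
      a * αX₂ b c - αX₂ (a * b) c + αX₂ a (b * c) - αX₂ a b * c
        = αX₁ (αX₁ a b) c - αX₁ a (αX₁ b c))
    (α₁ : A →ₗ[k] E →ₗ[k] E)
    (h1 : ∀ (a b : A) (e : E),
      a • α₁ b e - α₁ (a * b) e + α₁ a (b • e) = αX₁ a b • e) :
    ∀ (a b c : A) (e : E),
      (let G : A → A → E → E := fun a b e =>
        αX₂ a b • e + α₁ (αX₁ a b) e - α₁ a (α₁ b e);
      a • G b c e - G (a * b) c e + G a (b * c) e - G a b (c • e) = 0) := by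
  intro a b c e
  have e1 := h1 (αX₁ a b) c e
  have e2 := h1 a (αX₁ b c) e
  have e3 := h1 a b (α₁ c e)
  have e4 := congrArg (α₁ a) (h1 b c e)
  have e5 := congrArg (fun x => α₁ x e) (hX1 a b c)
  have e6 := congrArg (fun x => x • e) (hX2 a b c)
  simp only [map_add, map_sub, map_zero, LinearMap.add_apply, LinearMap.sub_apply,
    LinearMap.zero_apply] at e4 e5
  simp only [add_smul, sub_smul, mul_smul] at e6
  simp only [smul_add, smul_sub]
  linear_combination (norm := module) e6 - e1 + e2 - e3 + e4 + e5
end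

section
/- Let k be a commutative ring, A a commutative k-algebra, I an ideal, and E an A-module with I·E = 0. (a) If β : A × E → E is k-bilinear and satisfies a·β(b,e) − β(ab,e) + β(a,b·e) = 0 for all a,b ∈ A, e ∈ E, then for all x ∈ I, a ∈ A, e ∈ E: β(ax,e) = a·β(x,e) and β(x,a·e) = a·β(x,e). (b) If β : A × A × E → E is k-multilinear and satisfies a·β(b,c,e) − β(ab,c,e) + β(a,bc,e) − β(a,b,c·e) = 0 for all a,b,c ∈ A, e ∈ E, then the antisymmetrization S(x,y,e) := β(x,y,e) − β(y,x,e) satisfies, for all x,y ∈ I, a ∈ A, e ∈ E: S(ax,y,e) = a·S(x,y,e), S(x,ay,e) = a·S(x,y,e), and S(x,y,a·e) = a·S(x,y,e). -/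
/-- (a) A 1-cocycle β in Hom_k(A ⊗ E, E) is A-bilinear when its first
argument is restricted to I; (b) the antisymmetrization of a 2-cocycle
β in Hom_k(A ⊗ A ⊗ E, E) is A-polylinear when its first two arguments are restricted
to I. -/
theorem cocycle_restricted_to_ideal_is_polylinear
    (k : Type*) [CommRing k] (A : Type*) [CommRing A] [Algebra k A]
    (I : Ideal A) (E : Type*) [AddCommGroup E] [Module A E]
    [Module k E] [IsScalarTower k A E]
    (hIE : ∀ x ∈ I, ∀ e : E, x • e = 0) :
    (∀ β : A →ₗ[k] E →ₗ[k] E,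
      (∀ (a b : A) (e : E), a • β b e - β (a * b) e + β a (b • e) = 0) →
      ∀ x ∈ I, ∀ (a : A) (e : E),
        β (a * x) e = a • β x e ∧ β x (a • e) = a • β x e) ∧
    (∀ β : A →ₗ[k] A →ₗ[k] E →ₗ[k] E,
      (∀ (a b c : A) (e : E),
        a • β b c e - β (a * b) c e + β a (b * c) e - β a b (c • e) = 0) →
      ∀ x ∈ I, ∀ y ∈ I, ∀ (a : A) (e : E),
        (β (a * x) y e - β y (a * x) e = a • (β x y e - β y x e)) ∧
        (β x (a * y) e - β (a * y) x e = a • (β x y e - β y x e)) ∧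
        (β x y (a • e) - β y x (a • e) = a • (β x y e - β y x e))) := by
  constructor
  · intro β h x hx a e
    have h1 := h a x e
    have h2 := h x a e
    rw [hIE x hx, map_zero, add_zero, sub_eq_zero] at h1
    rw [hIE x hx, mul_comm x a, zero_sub, neg_add_eq_zero] at h2
    exact ⟨h1.symm, by rw [← h2, h1]⟩
  · intro β h
    -- left multiplication in the first slot
    have key1 : ∀ x y : A, y ∈ I → ∀ (a : A) (e : E),
        β (a * x) y e = a • β x y e + β a (x * y) e := by
      intro x y hy a e
      have h1 := h a x y e
      rw [hIE y hy, map_zero, sub_zero] at h1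
      rw [← sub_eq_zero, ← neg_eq_zero, ← h1]
      abel
    -- a scalar moves between the first two slots
    have key2 : ∀ x ∈ I, ∀ y ∈ I, ∀ (a : A) (e : E),
        β (a * x) y e = β x (a * y) e := by
      intro x hx y hy a e
      have h1 := h x a y e
      rw [hIE x hx, hIE y hy, map_zero, sub_zero, zero_sub, neg_add_eq_zero, mul_comm x a] at h1
      exact h1
    have key3 : ∀ x ∈ I, ∀ (y a : A) (e : E),
        β x y (a • e) = β x (a * y) e - β (x * y) a e := by
      intro x hx y a e
      have h1 := h x y a e
      rw [hIE x hx, mul_comm y a, sub_eq_zero] at h1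
      rw [← h1]
      abel
    have main : ∀ x ∈ I, ∀ y ∈ I, ∀ (a : A) (e : E),
        β (a * x) y e - β y (a * x) e = a • (β x y e - β y x e) := by
      intro x hx y hy a e
      rw [← key2 y hy x hx, key1 x y hy, key1 y x hx, mul_comm y x, smul_sub]
      abel
    intro x hx y hy a e
    refine ⟨main x hx y hy a e, ?_, ?_⟩
    · rw [← neg_sub, main y hy x hx, ← smul_neg, neg_sub]
    · rw [← main x hx y hy a e, key3 x hx, key3 y hy, key2 x hx y hy, mul_comm y x]
      abel
end

section
/- Let k be a field of characteristic zero, A a smooth commutative k-algebra (formally smooth and of finite presentation over k), I an ideal such that B = A/I is also smooth over k, and E a finitely generated projective B-module viewed as an A-module with I·E = 0. Let R : A × E → E be a k-bilinear map. Then there exists a k-linear map β : E → E with β(a·e) − a·β(e) = R(a,e) for all a ∈ A, e ∈ E, if and only if R(x,e) = 0 for all x ∈ I, e ∈ E, and a·R(b,e) − R(ab,e) + R(a,b·e) = 0 for all a,b ∈ A, e ∈ E. -/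
universe u v

/-- HKR-type lemma, first part: In the smooth affine setting, a k-bilinear
map R : A × E → E is of the form R(a,e) = β(a·e) − a·β(e) for some k-linear β : E → E
if and only if R vanishes on I ⊗ E and is a Hochschild 1-cocycle. -/
theorem hkr_coboundary_iff_one
    (k : Type u) [Field k] [CharZero k]
    (A : Type u) [CommRing A] [Algebra k A]
    [Algebra.FormallySmooth k A] [Algebra.FinitePresentation k A]
    (I : Ideal A)
    [Algebra.FormallySmooth k (A ⧸ I)] [Algebra.FinitePresentation k (A ⧸ I)]
    (E : Type v) [AddCommGroup E] [Module (A ⧸ I) E]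
    [Module.Finite (A ⧸ I) E] [Module.Projective (A ⧸ I) E]
    [Module A E] [IsScalarTower A (A ⧸ I) E]
    [Module k E] [IsScalarTower k A E]
    (R : A →ₗ[k] E →ₗ[k] E) :
    (∃ β : E →ₗ[k] E, ∀ (a : A) (e : E), β (a • e) - a • β e = R a e) ↔
    ((∀ x ∈ I, ∀ e : E, R x e = 0) ∧
      (∀ (a b : A) (e : E), a • R b e - R (a * b) e + R a (b • e) = 0)) := by
  constructor
  · rintro ⟨β, hβ⟩
    have h0 : ∀ x ∈ I, ∀ e : E, x • e = 0 := by
      intro x hx e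
      rw [← algebraMap_smul (A ⧸ I) x e, Ideal.Quotient.algebraMap_eq,
        Ideal.Quotient.eq_zero_iff_mem.mpr hx, zero_smul]
    refine ⟨fun x hx e => ?_, fun a b e => ?_⟩
    · rw [← hβ, h0 x hx, h0 x hx, map_zero, sub_zero]
    · rw [← hβ, ← hβ, ← hβ, smul_sub, mul_smul, mul_smul]
      abel
  · rintro ⟨hI, hc⟩
    have hout : ∀ (a : A) (b : A ⧸ I), Ideal.Quotient.mk I a = b →
        ∀ e : E, R (Quotient.out b) e = R a e := by
      intro a b h e
      have h1 : Ideal.Quotient.mk I (Quotient.out b) = b := Quotient.out_eq b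
      have h2 := hI (Quotient.out b - a) (Ideal.Quotient.eq.mp (h1.trans h.symm)) e
      rw [map_sub, LinearMap.sub_apply, sub_eq_zero] at h2
      exact h2
    let R' : E → (A ⧸ I) →+ E := fun e =>
      AddMonoidHom.mk' (fun b => R (Quotient.out b) e) (by
        intro x y
        obtain ⟨x, rfl⟩ := Ideal.Quotient.mk_surjective x
        obtain ⟨y, rfl⟩ := Ideal.Quotient.mk_surjective y
        rw [hout (x + y) _ (map_add _ _ _), hout x _ rfl, hout y _ rfl, map_add,
          LinearMap.add_apply])
    have hR' : ∀ a e, R' e (Ideal.Quotient.mk I a) = R a e := fun a e => hout a _ rfl e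
    let γ : (E →₀ (A ⧸ I)) →+ E := Finsupp.liftAddHom R'
    obtain ⟨s, hs⟩ := Module.projective_def'.mp
      (inferInstance : Module.Projective (A ⧸ I) E)
    have hmk : ∀ (a : A) (e : E), Ideal.Quotient.mk I a • e = a • e := fun a e =>
      algebraMap_smul (A ⧸ I) a e
    have hγ : ∀ (a : A) (f : E →₀ (A ⧸ I)), γ (Ideal.Quotient.mk I a • f) =
        a • γ f + R a (Finsupp.linearCombination (A ⧸ I) id f) := by
      intro a f
      induction f using Finsupp.induction_linear with
      | zero => simp
      | add f g hf hg =>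
        rw [smul_add, map_add, map_add, map_add, map_add, hf, hg, smul_add]
        abel
      | single e b =>
        obtain ⟨b, rfl⟩ := Ideal.Quotient.mk_surjective b
        rw [Finsupp.smul_single, smul_eq_mul, ← map_mul, Finsupp.linearCombination_single]
        simp only [γ, Finsupp.liftAddHom_apply_single, hR', id, hmk]
        have := hc a b e
        rw [← sub_eq_zero, ← neg_eq_zero, ← this]
        abel
    have hβ : ∀ (a : A) (e : E), γ (s (a • e)) = a • γ (s e) + R a e := by
      intro a e
      have h := hγ a (s e)
      rw [← map_smul, hmk] at h
      rw [h]
      congr 2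
      exact LinearMap.congr_fun hs e
    have h1 : ∀ e, R 1 e = 0 := by
      intro e
      simpa using hc 1 1 e
    refine ⟨{ toFun := fun e => γ (s e), map_add' := ?_, map_smul' := ?_ }, ?_⟩
    · intro x y
      rw [map_add, map_add]
    · intro c e
      have h := hβ (algebraMap k A c) e
      rw [algebraMap_smul, algebraMap_smul, Algebra.algebraMap_eq_smul_one, R.map_smul,
        LinearMap.smul_apply, h1, smul_zero, add_zero] at h
      exact h
    · intro a e
      change γ (s (a • e)) - a • γ (s e) = R a e
      rw [hβ, add_sub_cancel_left]
end

section
/- Let k be a field of characteristic zero, A a smooth commutative k-algebra (formally smooth and of finite presentation over k), I an ideal such that B = A/I is also smooth over k, and E a finitely generated projective B-module viewed as an A-module with I·E = 0. Let G : A × A × E → E be a k-multilinear map. Then there exists a k-bilinear map ρ : A × E → E with a·ρ(b,e) − ρ(ab,e) + ρ(a,b·e) = G(a,b,e) for all a,b ∈ A, e ∈ E, if and only if G(x,y,e) = G(y,x,e) for all x,y ∈ I, e ∈ E, and a·G(b,c,e) − G(ab,c,e) + G(a,bc,e) − G(a,b,c·e) = 0 for all a,b,c ∈ A, e ∈ E.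 -/
universe u v

namespace HKRAux

open scoped TensorProduct

section Deriv

variable {k A : Type*} [Field k] [CommRing A] [Algebra k A]

/-- the canonical splitting of the conormal sequence, as a map out of `Ω[A⁄k]` -/
lemma exists_psi [Algebra.FormallySmooth k A] (I : Ideal A) [Algebra.FormallySmooth k (A ⧸ I)] :
    ∃ ψ : Ω[A⁄k] →ₗ[A] I.Cotangent, ∀ x : I, ψ (KaehlerDifferential.D k A x) = I.toCotangent x := by
  suffices H : ∀ J : Ideal A, J = RingHom.ker (algebraMap A (A ⧸ I)) →
      ∃ ψ : Ω[A⁄k] →ₗ[A] J.Cotangent,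
        ∀ x : J, ψ (KaehlerDifferential.D k A x) = J.toCotangent x by
    exact H I (by simp [Ideal.Quotient.algebraMap_eq, Ideal.mk_ker])
  rintro J rfl
  obtain ⟨l, hl⟩ := (Algebra.FormallySmooth.iff_split_injection (R := k) (P := A) (A := A ⧸ I)
    Ideal.Quotient.mk_surjective).mp inferInstance
  refine ⟨l.restrictScalars A ∘ₗ (TensorProduct.mk A (A ⧸ I) (Ω[A⁄k]) 1), fun x => ?_⟩
  have := LinearMap.congr_fun hl (Ideal.toCotangent _ x)
  rw [LinearMap.comp_apply, KaehlerDifferential.kerCotangentToTensor_toCotangent] at this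
  exact this

/-- Euler derivation estimate -/
lemma euler_pow (E : Derivation k A A) (J : Ideal A) (δ : A)
    (h0 : ∀ c, E c ∈ J) (h1 : ∀ c ∈ J, E c - δ * c ∈ J ^ 2) (n : ℕ) :
    ∀ c ∈ J ^ n, E c - (n : A) * δ * c ∈ J ^ (n + 1) := by
  induction n with
  | zero => intro c _; simpa using h0 c
  | succ n ih =>
    intro c hc
    rw [pow_succ'] at hc
    induction hc using Submodule.mul_induction_on' with
    | mem_mul_mem x hx y hy =>
      have e : E (x * y) - ((n + 1 : ℕ) : A) * δ * (x * y)
          = x * (E y - (n : A) * δ * y) + y * (E x - δ * x) := by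
        rw [Derivation.leibniz]; push_cast; simp only [smul_eq_mul]; ring
      rw [e]
      refine Ideal.add_mem _ ?_ ?_
      · rw [pow_succ']; exact Ideal.mul_mem_mul hx (ih y hy)
      · have : n + 1 + 1 = n + 2 := rfl
        rw [this, pow_add]; exact Ideal.mul_mem_mul hy (h1 x hx)
    | add x _ y _ hx hy =>
      have e : E (x + y) - ((n + 1 : ℕ) : A) * δ * (x + y)
        = (E x - ((n + 1 : ℕ) : A) * δ * x) + (E y - ((n + 1 : ℕ) : A) * δ * y) := by
        rw [map_add]; ring
      rw [e]; exact Ideal.add_mem _ hx hy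

/-- Koszul boundaries: vectors `s x` with `s` antisymmetric. -/
def bdry {ι : Type*} [Fintype ι] (x : ι → A) : Submodule A (ι → A) where
  carrier := {a | ∃ s : ι → ι → A, (∀ i j, s i j = - s j i) ∧ ∀ i, a i = ∑ j, s i j * x j}
  add_mem' := by
    rintro a b ⟨s, hs, ha⟩ ⟨t, ht, hb⟩
    refine ⟨fun i j => s i j + t i j, fun i j => ?_, fun i => ?_⟩
    · beta_reduce; rw [hs i j, ht i j]; ring
    · simp [ha, hb, add_mul, Finset.sum_add_distrib]
  zero_mem' := ⟨fun _ _ => 0, by simp, by simp⟩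
  smul_mem' := by
    rintro c a ⟨s, hs, ha⟩
    refine ⟨fun i j => c * s i j, fun i j => ?_, fun i => ?_⟩
    · beta_reduce; rw [hs i j]; ring
    · simp [ha, Finset.mul_sum, mul_assoc]

/-- Koszul cycles -/
def cyc {ι : Type*} [Fintype ι] (x : ι → A) : Submodule A (ι → A) where
  carrier := {a | ∑ j, x j * a j = 0}
  add_mem' := by
    intro a b ha hb
    simp only [Set.mem_ofPred_eq] at *
    simp [mul_add, Finset.sum_add_distrib, ha, hb]
  zero_mem' := by simp
  smul_mem' := by
    intro c a ha
    simp only [Set.mem_ofPred_eq] at *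
    simp only [Pi.smul_apply, smul_eq_mul]
    calc ∑ j, x j * (c * a j) = c * ∑ j, x j * a j := by
          rw [Finset.mul_sum]; exact Finset.sum_congr rfl fun _ _ => by ring
      _ = 0 := by rw [ha, mul_zero]

lemma smul_cyc_le {ι : Type*} [Fintype ι] [DecidableEq ι] (x : ι → A) :
    Ideal.span (Set.range x) • cyc x ≤ bdry x := by
  rw [Submodule.smul_le]
  intro r hr a ha
  induction hr using Submodule.span_induction with
  | mem r hr =>
    obtain ⟨l, rfl⟩ := hr
    change ∑ j, x j * a j = 0 at ha
    refine ⟨fun i j => (if j = l then a i else 0) - (if i = l then a j else 0),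
      fun i j => by ring, fun i => ?_⟩
    have h2 : ∑ j, a j * x j = 0 := by rw [← ha]; exact Finset.sum_congr rfl fun _ _ => mul_comm _ _
    by_cases hi : i = l
    · subst hi
      simp only [sub_mul, Finset.sum_sub_distrib, if_true, h2]
      simp [mul_comm]
    · simp [hi, mul_comm]
  | zero => simp
  | add r s _ _ hr hs => rw [add_smul]; exact add_mem hr hs
  | smul c r _ hr => rw [smul_assoc]; exact Submodule.smul_mem _ _ hr

lemma bdry_le {ι : Type*} [Fintype ι] [CharZero k] (x : ι → A) : bdry x ≤ cyc x := by
  rintro a ⟨s, hs, ha⟩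
  change ∑ j, x j * a j = 0
  set S := ∑ j, x j * a j with hS
  have h1 : S = ∑ i, ∑ j, x i * (s i j * x j) := by
    rw [hS]; exact Finset.sum_congr rfl fun i _ => by rw [ha, Finset.mul_sum]
  have h2 : S = - S := by
    conv_rhs => rw [h1, Finset.sum_comm]
    rw [h1, ← Finset.sum_neg_distrib]
    refine Finset.sum_congr rfl fun i _ => ?_
    rw [← Finset.sum_neg_distrib]
    refine Finset.sum_congr rfl fun j _ => ?_
    rw [hs i j]; ring
  have h3 : (2 : k) • S = 0 := by
    rw [two_smul]; nth_rewrite 1 [h2]; simp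
  exact (smul_eq_zero_iff_right (two_ne_zero)).mp h3

/-- Koszul exactness near the locus. -/
lemma koszul [CharZero k] [IsNoetherianRing A] {ι : Type*} [Fintype ι] [DecidableEq ι] (x : ι → A)
    (D : ι → Derivation k A A) (δ : A) (hD : ∀ i j, D i (x j) = if i = j then δ else 0)
    (a : ι → A) (ha : ∑ j, x j * a j = 0) : ∃ N : ℕ, δ ^ N • a ∈ bdry x := by
  classical
  set J := Ideal.span (Set.range x) with hJ
  set E : Derivation k A A := ∑ j, x j • D j with hE
  have hEc : ∀ c, E c = ∑ j, x j * D j c := by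
    intro c
    have e := map_sum (Derivation.coeFnAddMonoidHom (R := k) (A := A) (M := A))
      (fun j => x j • D j) Finset.univ
    have e' := congrFun e c
    rw [Finset.sum_apply] at e'
    exact e'
  have hx : ∀ j, x j ∈ J := fun j => Ideal.subset_span ⟨j, rfl⟩
  have h0 : ∀ c, E c ∈ J := by
    intro c; rw [hEc]; exact Ideal.sum_mem _ fun j _ => Ideal.mul_mem_right _ _ (hx j)
  have h1 : ∀ c ∈ J, E c - δ * c ∈ J ^ 2 := by
    intro c hc
    induction hc using Submodule.span_induction with
    | mem c hc =>
      obtain ⟨l, rfl⟩ := hc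
      have : E (x l) - δ * x l = 0 := by
        rw [hEc]; simp [hD, mul_comm]
      rw [this]; exact zero_mem _
    | zero => simp
    | add r s _ _ hr hs =>
      have e : E (r + s) - δ * (r + s) = (E r - δ * r) + (E s - δ * s) := by
        rw [map_add]; ring
      rw [e]; exact add_mem hr hs
    | smul c r hr' hr =>
      have e : E (c • r) - δ * (c • r) = c * (E r - δ * r) + r * E c := by
        rw [smul_eq_mul, Derivation.leibniz]; simp only [smul_eq_mul]; ring
      rw [e]
      refine add_mem (Ideal.mul_mem_left _ _ hr) ?_
      rw [pow_two]; exact Ideal.mul_mem_mul hr' (h0 c)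
  have h2 := euler_pow E J δ h0 h1
  have key : ∀ b ∈ cyc x, (fun i => E (b i) + δ * b i) ∈ bdry x := by
    intro b hb
    change ∑ j, x j * b j = 0 at hb
    refine ⟨fun i j => D j (b i) - D i (b j), fun i j => by ring, fun i => ?_⟩
    have e : ∑ j, (x j * D i (b j)) + δ * b i = 0 := by
      have := congrArg (D i) hb
      rw [map_sum, map_zero] at this
      simp only [Derivation.leibniz, smul_eq_mul, Finset.sum_add_distrib, hD] at this
      simpa [mul_comm] using this
    beta_reduce
    rw [hEc]
    simp only [sub_mul, Finset.sum_sub_distrib]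
    have e1 : ∑ j, D i (b j) * x j = - (δ * b i) := by
      rw [eq_neg_iff_add_eq_zero, ← e]
      congr 1
      exact Finset.sum_congr rfl fun _ _ => mul_comm _ _
    rw [e1, sub_neg_eq_add]
    congr 1
    exact Finset.sum_congr rfl fun _ _ => mul_comm _ _
  have step : ∀ n : ℕ, ∃ N : ℕ, ∃ b, b ∈ cyc x ∧ (∀ i, b i ∈ J ^ n) ∧ δ ^ N • a - b ∈ bdry x := by
    intro n
    induction n with
    | zero => exact ⟨0, a, ha, by simp, by simp⟩
    | succ n ih =>
      obtain ⟨N, b, hb, hbn, hab⟩ := ih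
      have hu : (algebraMap k A ((n + 1 : k)⁻¹)) * ((n : A) + 1) = 1 := by
        have : ((n : A) + 1) = algebraMap k A (n + 1) := by simp
        rw [this, ← map_mul, inv_mul_cancel₀ (Nat.cast_add_one_ne_zero n), map_one]
      set u := algebraMap k A ((n + 1 : k)⁻¹)
      have hk := (bdry x).smul_mem u (key b hb)
      have hw : δ • b - (-u) • (fun i => E (b i) - (n : A) * δ * b i)
          = u • (fun i => E (b i) + δ * b i) := by
        ext i
        simp only [Pi.sub_apply, Pi.smul_apply, smul_eq_mul]
        linear_combination (-(δ * b i)) * hu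
      refine ⟨N + 1, (-u) • (fun i => E (b i) - (n : A) * δ * b i), ?_, ?_, ?_⟩
      · have := (cyc x).sub_mem ((cyc x).smul_mem δ hb) (bdry_le (k := k) x (hw ▸ hk))
        simpa using this
      · intro i
        exact Ideal.mul_mem_left _ _ (h2 n _ (hbn i))
      · have := add_mem ((bdry x).smul_mem δ hab) (hw ▸ hk)
        rw [smul_sub, smul_smul, ← pow_succ'] at this
        convert this using 1
        abel
  obtain ⟨K, hK⟩ := Ideal.exists_pow_inf_eq_pow_smul J (cyc x)
  obtain ⟨N, b, hb, hbn, hab⟩ := step (K + 1)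
  have hb' : b ∈ J ^ (K + 1) • (⊤ : Submodule A (ι → A)) ⊓ cyc x := by
    refine ⟨?_, hb⟩
    rw [← Finset.univ_sum_single b]
    refine sum_mem fun i _ => ?_
    have : (Pi.single i (b i) : ι → A) = b i • Pi.single i 1 := by
      rw [← Pi.single_smul]; simp
    rw [this]
    exact Submodule.smul_mem_smul (hbn i) trivial
  rw [hK (K + 1) (by omega)] at hb'
  have hb2 : b ∈ bdry x := by
    apply smul_cyc_le x
    have : K + 1 - K = 1 := by omega
    rw [this, pow_one] at hb'
    exact Submodule.smul_mono le_rfl inf_le_right hb'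
  exact ⟨N, by simpa using add_mem hab hb2⟩

end Deriv

section Local

variable {k A : Type*} [Field k] [CommRing A] [Algebra k A]

lemma local_data [Algebra.FormallySmooth k A] [IsNoetherianRing A] (I : Ideal A)
    (ψ : Ω[A⁄k] →ₗ[A] I.Cotangent)
    (hψ : ∀ x : I, ψ (KaehlerDifferential.D k A x) = I.toCotangent x)
    (m : Ideal A) [hm : m.IsMaximal] (hI : I ≤ m) :
    ∃ (r : ℕ) (x : Fin r → I) (D : Fin r → Derivation k A A) (δ f : A),
      δ ∉ m ∧ f ∉ m ∧ (∀ i j, D i (x j) = if i = j then δ else 0) ∧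
      ∀ c ∈ I, f * c ∈ Ideal.span (Set.range fun j => (x j : A)) := by
  classical
  let _ : Field (A ⧸ m) := Ideal.Quotient.field m
  let V := I ⧸ (m • ⊤ : Submodule A I)
  have : Module.Finite (A ⧸ m) V := Module.Finite.of_restrictScalars_finite A (A ⧸ m) V
  let b := Module.finBasis (A ⧸ m) V
  set r := Module.finrank (A ⧸ m) V
  have hx' : ∀ j, ∃ x : I, Submodule.Quotient.mk x = b j := fun j =>
    Submodule.Quotient.mk_surjective _ (b j)
  choose x hx using hx'
  let pV : I.Cotangent →ₗ[A] V :=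
    Submodule.mapQ _ _ LinearMap.id (by
      rw [Submodule.comap_id]; exact Submodule.smul_mono hI le_rfl)
  have hpV : ∀ y : I, pV (I.toCotangent y) = Submodule.Quotient.mk y := fun y => rfl
  let ℓ : Fin r → Ω[A⁄k] →ₗ[A] (A ⧸ m) := fun i => (b.coord i).restrictScalars A ∘ₗ pV ∘ₗ ψ
  have hL : ∀ i, ∃ L : Ω[A⁄k] →ₗ[A] A, (Algebra.linearMap A (A ⧸ m)) ∘ₗ L = ℓ i := fun i =>
    Module.projective_lifting_property _ _ Ideal.Quotient.mk_surjective
  choose L hL using hL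
  let D0 : Fin r → Derivation k A A := fun i => (L i).compDer (KaehlerDifferential.D k A)
  let P : Matrix (Fin r) (Fin r) A := fun i j => D0 i (x j)
  have hP : (Ideal.Quotient.mk m).mapMatrix P = 1 := by
    ext i j
    have := LinearMap.congr_fun (hL i) (KaehlerDifferential.D k A (x j))
    have h2 : ℓ i (KaehlerDifferential.D k A (x j)) = if j = i then 1 else 0 := by
      simp only [ℓ, LinearMap.comp_apply, hψ, hpV, hx]
      simp [Finsupp.single_apply]
    rw [h2] at this
    rw [Matrix.one_apply]
    simp only [eq_comm (a := i)]
    exact this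
  have hdet : P.det ∉ m := by
    rw [← Ideal.Quotient.eq_zero_iff_mem, RingHom.map_det, hP, Matrix.det_one]
    exact one_ne_zero
  let D : Fin r → Derivation k A A := fun i => ∑ l, P.adjugate i l • D0 l
  have hDc : ∀ i c, D i c = ∑ l, P.adjugate i l * D0 l c := by
    intro i c
    have e := map_sum (Derivation.coeFnAddMonoidHom (R := k) (A := A) (M := A))
      (fun l => P.adjugate i l • D0 l) Finset.univ
    have e' := congrFun e c
    rw [Finset.sum_apply] at e'
    exact e'
  have hN : I ≤ Ideal.span (Set.range fun j => (x j : A)) ⊔ m • I := by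
    intro c hc
    have hrep := b.sum_repr (Submodule.Quotient.mk ⟨c, hc⟩ : V)
    have ha : ∀ i, ∃ a : A, Ideal.Quotient.mk m a = b.repr (Submodule.Quotient.mk ⟨c, hc⟩ : V) i :=
      fun i => Ideal.Quotient.mk_surjective _
    choose a ha using ha
    have h1 : (Submodule.Quotient.mk (∑ i, a i • x i) : V) = Submodule.Quotient.mk ⟨c, hc⟩ := by
      rw [← hrep, ← Submodule.mkQ_apply, map_sum]
      refine Finset.sum_congr rfl fun i _ => ?_
      rw [map_smul, Submodule.mkQ_apply, hx, ← ha]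
      rfl
    rw [eq_comm, Submodule.Quotient.eq] at h1
    have h2 : c - ∑ i, a i * (x i : A) ∈ m • I := by
      have := Submodule.mem_map_of_mem (f := I.subtype) h1
      rw [Submodule.map_smul'', Submodule.map_top, Submodule.range_subtype] at this
      simpa using this
    have h3 : c = ∑ i, a i * (x i : A) + (c - ∑ i, a i * (x i : A)) := by ring
    rw [h3]
    refine Submodule.add_mem_sup (Ideal.sum_mem _ fun i _ => ?_) h2
    exact Ideal.mul_mem_left _ _ (Ideal.subset_span ⟨i, rfl⟩)
  obtain ⟨f, hf, hfI⟩ := Submodule.exists_sub_one_mem_and_smul_le_of_fg_of_le_sup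
    (IsNoetherian.noetherian I) le_rfl hN
  refine ⟨r, x, D, P.det, f, hdet, ?_, ?_, ?_⟩
  · intro hfm
    apply hm.ne_top
    rw [Ideal.eq_top_iff_one]
    simpa using m.sub_mem hfm hf
  · intro i j
    rw [hDc]
    have := congrFun (congrFun P.adjugate_mul i) j
    rw [Matrix.mul_apply, Matrix.smul_apply, Matrix.one_apply] at this
    rw [show (∑ l, P.adjugate i l * D0 l (x j)) = _ from this]
    simp
  · intro c hc
    exact hfI (Submodule.smul_mem_pointwise_smul c f I hc)

/-- the multiplication `I ⊗ I → I` -/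
def mulMap (I : Ideal A) : I ⊗[A] I →ₗ[A] I :=
  TensorProduct.lift ((LinearMap.lsmul A I).comp I.subtype)

@[simp] lemma mulMap_tmul (I : Ideal A) (x y : I) : mulMap I (x ⊗ₜ y) = (x : A) • y := rfl

/-- antisymmetric tensors -/
def asym (I : Ideal A) : Submodule A (I ⊗[A] I) :=
  Submodule.span A {t | ∃ x y : I, t = x ⊗ₜ y - y ⊗ₜ x}

lemma smul_tensor (I : Ideal A) (f : I) (t : I ⊗[A] I) : (f : A) • t = f ⊗ₜ mulMap I t := by
  induction t with
  | zero => simp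
  | add a b ha hb => rw [smul_add, ha, hb, map_add, TensorProduct.tmul_add]
  | tmul u v =>
    rw [mulMap_tmul, TensorProduct.tmul_smul,
      TensorProduct.smul_tmul', TensorProduct.smul_tmul']
    congr 1
    ext
    simp [mul_comm]

lemma gen_tensor (I : Ideal A) {r : ℕ} (x : Fin r → I) (f : A)
    (hf : ∀ c ∈ I, f * c ∈ Ideal.span (Set.range fun j => (x j : A))) (t : I ⊗[A] I) :
    ∃ a : Fin r → I, f • t = ∑ j, x j ⊗ₜ[A] a j := by
  induction t with
  | zero => exact ⟨0, by simp⟩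
  | add s t hs ht =>
    obtain ⟨a, ha⟩ := hs
    obtain ⟨b, hb⟩ := ht
    exact ⟨a + b, by simp [ha, hb, TensorProduct.tmul_add, Finset.sum_add_distrib]⟩
  | tmul u v =>
    obtain ⟨c, hc⟩ := (Ideal.mem_span_range_iff_exists_fun).mp (hf u u.2)
    refine ⟨fun j => c j • v, ?_⟩
    have : f • u = ∑ j, c j • x j := by
      ext; simp [hc]
    rw [TensorProduct.smul_tmul', this, TensorProduct.sum_tmul]
    simp [TensorProduct.smul_tmul]

theorem ker_le_asym [CharZero k] [Algebra.FormallySmooth k A] [IsNoetherianRing A] (I : Ideal A)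
    [Algebra.FormallySmooth k (A ⧸ I)] (t : I ⊗[A] I) (ht : mulMap I t = 0) : t ∈ asym I := by
  obtain ⟨ψ, hψ⟩ := exists_psi (k := k) I
  let C : Ideal A := (asym I).comap (LinearMap.toSpanSingleton A _ t)
  have hC : ∀ f, f ∈ C ↔ f • t ∈ asym I := fun f => Iff.rfl
  suffices C = ⊤ by
    have h1 : (1 : A) ∈ C := this ▸ trivial
    simpa using (hC 1).mp h1
  by_contra hne
  obtain ⟨m, hm, hCm⟩ := Ideal.exists_le_maximal C hne
  by_cases hI : I ≤ m
  · obtain ⟨r, x, D, δ, f, hδ, hf, hD, hfI⟩ := local_data I ψ hψ m hI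
    obtain ⟨a, ha⟩ := gen_tensor I x f hfI t
    have hrel : ∑ j, (x j : A) * (a j : A) = 0 := by
      have := congrArg (mulMap I) ha
      rw [map_smul, ht, map_sum, smul_zero] at this
      simpa using congrArg I.subtype this.symm
    obtain ⟨N, s, hs, hsa⟩ := koszul (k := k) (fun j => (x j : A)) D δ hD _ hrel
    have hsa' : ∀ i, δ ^ N • a i = ∑ j, s i j • x j := by
      intro i; ext; simpa using hsa i
    have hmem : (2 * δ ^ N * f) ∈ C := by
      rw [hC, mul_assoc, mul_smul, mul_smul, ha, Finset.smul_sum]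
      have e : ∑ i, δ ^ N • (x i ⊗ₜ[A] a i) = ∑ i, ∑ j, s i j • (x i ⊗ₜ[A] x j) := by
        refine Finset.sum_congr rfl fun i _ => ?_
        rw [← TensorProduct.tmul_smul, hsa', TensorProduct.tmul_sum]
        simp
      have e2 : ∑ i, ∑ j, s i j • (x i ⊗ₜ[A] x j) = - ∑ i, ∑ j, s i j • (x j ⊗ₜ[A] x i) := by
        rw [Finset.sum_comm, ← Finset.sum_neg_distrib]
        refine Finset.sum_congr rfl fun i _ => ?_
        rw [← Finset.sum_neg_distrib]
        refine Finset.sum_congr rfl fun j _ => ?_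
        rw [hs j i]
        exact neg_smul (M := I ⊗[A] I) _ _
      rw [e, two_smul]
      nth_rewrite 2 [e2]
      rw [← sub_eq_add_neg, ← Finset.sum_sub_distrib]
      refine sum_mem fun i _ => ?_
      rw [← Finset.sum_sub_distrib]
      refine sum_mem fun j _ => ?_
      have := Submodule.smul_mem (asym I) (s i j) (Submodule.subset_span ⟨x i, x j, rfl⟩)
      have e3 := smul_sub (A := I ⊗[A] I) (s i j) (x i ⊗ₜ[A] x j) (x j ⊗ₜ[A] x i)
      exact e3 ▸ this
    have hmp := hm.isPrime
    rcases hmp.mem_or_mem (hCm hmem) with h | h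
    · rcases hmp.mem_or_mem h with h | h
      · apply hm.ne_top
        refine Ideal.eq_top_of_isUnit_mem _ h ?_
        have : (2 : A) = algebraMap k A 2 := (map_ofNat _ 2).symm
        rw [this]
        exact (IsUnit.mk0 (2 : k) two_ne_zero).map _
      · exact hδ (hmp.mem_of_pow_mem _ h)
    · exact hf h
  · obtain ⟨f, hfI, hfm⟩ := Set.not_subset.mp hI
    apply hfm
    apply hCm
    rw [hC, smul_tensor I ⟨f, hfI⟩ t, ht, TensorProduct.tmul_zero]
    exact zero_mem _

end Local

section Twist

variable {A : Type*} [CommRing A] {I : Ideal A} {F : Type*} [AddCommGroup F] [Module A F]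

/-- cocycle data for an extension of `I` by `F`. -/
structure Cocyc (A : Type*) [CommRing A] (I : Ideal A) (F : Type*) [AddCommGroup F] [Module A F] where
  g : A →+ I →+ F
  one : ∀ c, g 1 c = 0
  cocycle : ∀ a b c, g (a * b) c = a • g b c + g a (b • c)

/-- The extension module attached to a cocycle. -/
def TwX (_ : Cocyc A I F) : Type _ := F × I

instance (G : Cocyc A I F) : AddCommGroup (TwX G) := inferInstanceAs (AddCommGroup (F × I))

/-- constructor -/
def TwX.mk (G : Cocyc A I F) (φ : F) (c : I) : TwX G := (φ, c)

instance (G : Cocyc A I F) : Module A (TwX G) where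
  smul a x := TwX.mk G (a • x.1 + G.g a x.2) (a • x.2)
  one_smul x := Prod.ext (by
    change (1 : A) • x.1 + G.g 1 x.2 = x.1
    simp [G.one]) (one_smul A x.2)
  mul_smul a b x := Prod.ext (by
    change (a * b) • x.1 + G.g (a * b) x.2 = a • (b • x.1 + G.g b x.2) + G.g a (b • x.2)
    rw [G.cocycle, mul_smul, smul_add, add_assoc]) (mul_smul a b x.2)
  smul_zero a := Prod.ext (by
    change a • (0 : F) + G.g a (0 : I) = 0
    simp) (smul_zero a)
  smul_add a x y := Prod.ext (by
    change a • (x.1 + y.1) + G.g a (x.2 + y.2) = (a • x.1 + G.g a x.2) + (a • y.1 + G.g a y.2)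
    rw [smul_add, map_add]; abel) (smul_add a x.2 y.2)
  add_smul a b x := Prod.ext (by
    change (a + b) • x.1 + G.g (a + b) x.2 = (a • x.1 + G.g a x.2) + (b • x.1 + G.g b x.2)
    rw [add_smul, map_add, AddMonoidHom.add_apply]; abel) (add_smul a b x.2)
  zero_smul x := Prod.ext (by
    change (0 : A) • x.1 + G.g 0 x.2 = 0
    simp) (zero_smul A x.2)

variable (G : Cocyc A I F)

lemma TwX.smul_mk (a : A) (φ : F) (c : I) :
    a • TwX.mk G φ c = TwX.mk G (a • φ + G.g a c) (a • c) := rfl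

/-- inclusion -/
def TwX.inl : F →ₗ[A] TwX G where
  toFun φ := TwX.mk G φ 0
  map_add' φ φ' := Prod.ext rfl (add_zero (0 : I)).symm
  map_smul' a φ := by
    rw [RingHom.id_apply, TwX.smul_mk]; simp

/-- projection -/
def TwX.snd : TwX G →ₗ[A] I where
  toFun x := x.2
  map_add' _ _ := rfl
  map_smul' _ _ := rfl

theorem twist_split {k : Type*} [Field k] [CharZero k] [Algebra k A] [Algebra.FormallySmooth k A]
    [IsNoetherianRing A] [Algebra.FormallySmooth k (A ⧸ I)]
    (hF : ∀ x ∈ I, ∀ φ : F, x • φ = 0)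
    (hsym : ∀ x y : I, G.g x y = G.g y x) :
    ∃ ρ : I →+ F, ∀ a c, a • ρ c - ρ (a • c) = G.g a c := by
  obtain ⟨ψ, hψ⟩ := exists_psi (k := k) I
  let IX : Submodule A (TwX G) := I • ⊤
  let q : TwX G →ₗ[A] TwX G ⧸ IX := IX.mkQ
  have hq : ∀ x ∈ I, ∀ y : TwX G ⧸ IX, x • y = 0 := by
    intro x hx y
    obtain ⟨y, rfl⟩ := IX.mkQ_surjective y
    rw [← map_smul, Submodule.mkQ_apply, Submodule.Quotient.mk_eq_zero]
    exact Submodule.smul_mem_smul hx trivial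
  -- tensor map `I ⊗ I → X`
  let θ0 : I →ₗ[A] I →ₗ[A] TwX G :=
    { toFun := fun x =>
        { toFun := fun c => TwX.mk G (G.g x c) ((x : A) • c)
          map_add' := fun c d => Prod.ext (map_add (G.g x) c d) (smul_add (x : A) c d)
          map_smul' := fun a c => by
            rw [RingHom.id_apply, TwX.smul_mk]
            refine Prod.ext ?_ (smul_comm (x : A) a c)
            change G.g x (a • c) = a • G.g x c + G.g a ((x : A) • c)
            have h1 := G.cocycle a x c
            have h2 := G.cocycle x a c
            rw [mul_comm, h1, hF x x.2, zero_add] at h2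
            exact h2.symm }
      map_add' := fun x y => LinearMap.ext fun c => Prod.ext (by
          change G.g ((x : A) + y) c = G.g x c + G.g y c
          rw [map_add]; rfl) (add_smul (x : A) y c)
      map_smul' := fun a x => LinearMap.ext fun c => by
        change TwX.mk G (G.g (a * (x : A)) c) ((a * (x : A)) • c) =
          a • TwX.mk G (G.g x c) ((x : A) • c)
        rw [TwX.smul_mk, G.cocycle, mul_smul] }
  let θ : I ⊗[A] I →ₗ[A] TwX G := TensorProduct.lift θ0
  have hθ : ∀ x c : I, θ (x ⊗ₜ c) = TwX.mk G (G.g x c) ((x : A) • c) := fun x c => rfl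
  have hθsnd : ∀ t, TwX.snd G (θ t) = mulMap I t := by
    intro t
    induction t with
    | zero => simp
    | add s t hs ht => simp only [map_add, hs, ht]
    | tmul x y => rfl
  have hθasym : ∀ t ∈ asym I, θ t = 0 := by
    intro t ht
    have : asym I ≤ LinearMap.ker θ := by
      refine Submodule.span_le.mpr ?_
      rintro _ ⟨x, y, rfl⟩
      change θ (x ⊗ₜ y - y ⊗ₜ x) = 0
      rw [map_sub, hθ, hθ, sub_eq_zero, hsym]
      congr 1
      ext
      simp [mul_comm]
    exact this ht
  have hθrange : ∀ z ∈ IX, ∃ t, θ t = z := by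
    intro z hz
    have : IX ≤ LinearMap.range θ := by
      refine Submodule.smul_le.mpr ?_
      rintro x hx ⟨φ, c⟩ -
      refine ⟨⟨x, hx⟩ ⊗ₜ c, ?_⟩
      rw [hθ]
      change _ = TwX.mk G (x • φ + G.g x c) (x • c)
      rw [hF x hx, zero_add]
    exact this hz
  have hinj : Function.Injective (q ∘ₗ TwX.inl G) := by
    rw [← LinearMap.ker_eq_bot, LinearMap.ker_eq_bot']
    intro φ hφ
    rw [LinearMap.comp_apply, Submodule.mkQ_apply, Submodule.Quotient.mk_eq_zero] at hφ
    obtain ⟨t, ht⟩ := hθrange _ hφ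
    have h1 : mulMap I t = 0 := by rw [← hθsnd, ht]; rfl
    have h2 := hθasym t (ker_le_asym (k := k) I t h1)
    rw [ht] at h2
    exact congrArg Prod.fst h2
  -- the section
  let pc : TwX G ⧸ IX →ₗ[A] I.Cotangent := IX.liftQ (I.toCotangent ∘ₗ TwX.snd G) (by
    refine Submodule.smul_le.mpr fun x hx y _ => ?_
    rw [LinearMap.mem_ker, map_smul]
    obtain ⟨w, hw⟩ : ∃ w, w = (I.toCotangent ∘ₗ TwX.snd G) y := ⟨_, rfl⟩
    obtain ⟨w', rfl⟩ := I.toCotangent_surjective w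
    rw [← hw, ← map_smul, Ideal.toCotangent_eq_zero, pow_two]
    exact Ideal.mul_mem_mul hx w'.2)
  have hpc : ∀ y, pc (q y) = I.toCotangent (TwX.snd G y) := fun y => rfl
  have hpcs : Function.Surjective pc := by
    intro w
    obtain ⟨c, rfl⟩ := I.toCotangent_surjective w
    exact ⟨q (TwX.mk G 0 c), rfl⟩
  obtain ⟨h, hh⟩ := Module.projective_lifting_property pc ψ hpcs
  let s : I →ₗ[A] TwX G ⧸ IX :=
    { toFun := fun c => h (KaehlerDifferential.D k A c)
      map_add' := by intro c d; simp
      map_smul' := by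
        intro a c
        simp only [RingHom.id_apply, Submodule.coe_smul, smul_eq_mul, Derivation.leibniz, map_add,
          map_smul]
        rw [hq c c.2, add_zero] }
  have hs : ∀ c, pc (s c) = I.toCotangent c := fun c => by
    rw [← hψ, ← hh]; rfl
  let l : TwX G →ₗ[A] TwX G ⧸ IX := q - s ∘ₗ TwX.snd G
  have hker : ∀ y, pc y = 0 → y ∈ LinearMap.range (q ∘ₗ TwX.inl G) := by
    intro y hy
    obtain ⟨⟨φ, c⟩, rfl⟩ := IX.mkQ_surjective y
    have hc : I.toCotangent c = 0 := hy
    rw [Ideal.toCotangent_eq_zero, pow_two] at hc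
    have : ∃ t, mulMap I t = c := by
      obtain ⟨c, hcI⟩ := c
      have hc' : c ∈ (LinearMap.range (mulMap I)).map I.subtype := by
        refine (Submodule.mul_le (M := I) (N := I) (P := (LinearMap.range (mulMap I)).map I.subtype)).mpr ?_ hc
        intro x hx y hy
        exact ⟨_, ⟨⟨x, hx⟩ ⊗ₜ ⟨y, hy⟩, rfl⟩, rfl⟩
      obtain ⟨_, ⟨t, rfl⟩, ht⟩ := hc'
      exact ⟨t, Subtype.ext ht⟩
    obtain ⟨t, ht⟩ := this
    have hθm : θ t ∈ IX := by
      clear ht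
      induction t with
      | zero => simp
      | add s t hs ht => rw [map_add]; exact add_mem hs ht
      | tmul x y =>
        have : θ (x ⊗ₜ y) = (x : A) • TwX.mk G 0 y := by
          rw [hθ, TwX.smul_mk]; simp
        rw [this]
        exact Submodule.smul_mem_smul x.2 trivial
    refine ⟨φ - (θ t).1, ?_⟩
    have e : TwX.inl G (φ - (θ t).1) = TwX.mk G φ c - θ t := by
      refine Prod.ext rfl ?_
      change (0 : I) = c - TwX.snd G (θ t)
      rw [hθsnd, ht, sub_self]
    rw [LinearMap.comp_apply, e, map_sub]
    have : q (θ t) = 0 := by rwa [Submodule.mkQ_apply, Submodule.Quotient.mk_eq_zero]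
    rw [this, sub_zero]
    rfl
  have hl : ∀ x, l x ∈ LinearMap.range (q ∘ₗ TwX.inl G) := by
    intro x
    apply hker
    rw [LinearMap.sub_apply, map_sub, hpc, LinearMap.comp_apply, hs, sub_self]
  let r : TwX G →ₗ[A] F :=
    (LinearEquiv.ofInjective _ hinj).symm.toLinearMap ∘ₗ l.codRestrict _ hl
  have hr : ∀ φ, r (TwX.inl G φ) = φ := by
    intro φ
    change (LinearEquiv.ofInjective _ hinj).symm _ = _
    rw [LinearEquiv.symm_apply_eq]
    ext
    change q (TwX.inl G φ) - s (0 : I) = _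
    rw [map_zero, sub_zero]; rfl
  refine ⟨{ toFun := fun c => r (TwX.mk G 0 c), map_zero' := map_zero r, map_add' := ?_ }, ?_⟩
  · intro c d
    rw [← map_add]
    congr 1
    exact Prod.ext (add_zero (0 : F)).symm rfl
  · intro a c
    change a • r (TwX.mk G 0 c) - r (TwX.mk G 0 (a • c)) = _
    rw [← map_smul, ← map_sub]
    conv_rhs => rw [← hr (G.g a c)]
    congr 1
    rw [TwX.smul_mk]
    refine Prod.ext ?_ ?_
    · change (a • (0 : F) + G.g a c) - 0 = G.g a c
      simp
    · exact sub_self (a • c)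

end Twist

section Final

variable {k A : Type*} [Field k] [CommRing A] [Algebra k A] (I : Ideal A)
    {E : Type*} [AddCommGroup E] [Module (A ⧸ I) E] [Module.Projective (A ⧸ I) E]
    [Module A E] [IsScalarTower A (A ⧸ I) E] [Module k E] [IsScalarTower k A E]

/-- If the cocycle kills `A ⊗ I`, it is a coboundary, by projectivity of `E`. -/
lemma coboundary_of_kills (G : A →ₗ[k] A →ₗ[k] E →ₗ[k] E)
    (hG : ∀ a, ∀ c ∈ I, G a c = 0)
    (hc : ∀ (a b c : A) (e : E),
        a • G b c e - G (a * b) c e + G a (b * c) e - G a b (c • e) = 0) :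
    ∃ ρ : A →ₗ[k] E →ₗ[k] E,
      ∀ (a b : A) (e : E), a • ρ b e - ρ (a * b) e + ρ a (b • e) = G a b e := by
  have : IsScalarTower k (A ⧸ I) E := by
    constructor
    intro x y e
    obtain ⟨y, rfl⟩ := Ideal.Quotient.mk_surjective y
    have h1 : x • (Ideal.Quotient.mk I y) = Ideal.Quotient.mk I (x • y) := rfl
    have h2 : ∀ a : A, ∀ e : E, Ideal.Quotient.mk I a • e = a • e := fun a e => by
      rw [← algebraMap_smul (A ⧸ I) a e]; rfl
    rw [h1, h2, h2, smul_assoc]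
  have hmk : ∀ a : A, ∀ e : E, Ideal.Quotient.mk I a • e = a • e := fun a e => by
    rw [← algebraMap_smul (A ⧸ I) a e]; rfl
  obtain ⟨s, hs⟩ := Module.projective_def'.mp (inferInstance : Module.Projective (A ⧸ I) E)
  -- descend `G a` to the quotient
  let Gb : A → (A ⧸ I) →ₗ[k] E →ₗ[k] E := fun a =>
    (Submodule.liftQ (I.restrictScalars k) (G a) (fun c hc => hG a c hc)) ∘ₗ
      (Submodule.Quotient.restrictScalarsEquiv k I).symm.toLinearMap
  have hGb : ∀ a c, Gb a (Ideal.Quotient.mk I c) = G a c := fun a c => rfl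
  let Γ0 : A → (E →₀ (A ⧸ I)) →ₗ[k] E := fun a => Finsupp.lsum k (fun e => (Gb a).flip e)
  have hΓ0 : ∀ a e c, Γ0 a (Finsupp.single e (Ideal.Quotient.mk I c)) = G a c e := by
    intro a e c
    change Finsupp.lsum k (fun e => (Gb a).flip e) _ = _
    rw [Finsupp.lsum_single, LinearMap.flip_apply, hGb]
  let Γ : A →ₗ[k] (E →₀ (A ⧸ I)) →ₗ[k] E :=
    { toFun := Γ0
      map_add' := by
        intro a b
        refine Finsupp.lhom_ext fun e c => ?_
        obtain ⟨c, rfl⟩ := Ideal.Quotient.mk_surjective c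
        rw [LinearMap.add_apply, hΓ0, hΓ0, hΓ0, map_add]; rfl
      map_smul' := by
        intro t b
        refine Finsupp.lhom_ext fun e c => ?_
        obtain ⟨c, rfl⟩ := Ideal.Quotient.mk_surjective c
        rw [LinearMap.smul_apply, hΓ0, hΓ0, map_smul]; rfl }
  have hΓ : ∀ a e c, Γ a (Finsupp.single e (Ideal.Quotient.mk I c)) = G a c e := hΓ0
  have key : ∀ (a b : A) (z : E →₀ (A ⧸ I)),
      a • Γ b z - Γ (a * b) z + Γ a (Ideal.Quotient.mk I b • z) =
        G a b (Finsupp.linearCombination (A ⧸ I) id z) := by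
    intro a b z
    induction z using Finsupp.induction_linear with
    | zero => simp
    | add z w hz hw =>
      simp only [map_add, smul_add, ← hz, ← hw]; abel
    | single e c =>
      obtain ⟨c, rfl⟩ := Ideal.Quotient.mk_surjective c
      rw [Finsupp.smul_single, smul_eq_mul, ← map_mul, hΓ, hΓ, hΓ,
        Finsupp.linearCombination_single, id, hmk]
      exact sub_eq_zero.mp (hc a b c e)
  refine ⟨{ toFun := fun a => Γ a ∘ₗ s.restrictScalars k, map_add' := ?_, map_smul' := ?_ }, ?_⟩
  · intro a b; ext e; simp
  · intro a b; ext e; simp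
  · intro a b e
    have h1 := key a b (s e)
    have h2 : Finsupp.linearCombination (A ⧸ I) id (s e) = e := LinearMap.congr_fun hs e
    rw [h2, ← map_smul s, hmk] at h1
    exact h1

end Final

end HKRAux

/-- HKR-type lemma, second part: In the smooth affine setting, a
k-multilinear map G : A × A × E → E is of the form G(a,b,e) = a·ρ(b,e) − ρ(ab,e) +
ρ(a,b·e) for some k-bilinear ρ : A × E → E if and only if G is symmetric in its first
two arguments on I × I × E and is a Hochschild 2-cocycle. -/
theorem hkr_coboundary_iff_two
    (k : Type u) [Field k] [CharZero k]
    (A : Type u) [CommRing A] [Algebra k A]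
    [Algebra.FormallySmooth k A] [Algebra.FinitePresentation k A]
    (I : Ideal A)
    [Algebra.FormallySmooth k (A ⧸ I)] [Algebra.FinitePresentation k (A ⧸ I)]
    (E : Type v) [AddCommGroup E] [Module (A ⧸ I) E]
    [Module.Finite (A ⧸ I) E] [Module.Projective (A ⧸ I) E]
    [Module A E] [IsScalarTower A (A ⧸ I) E]
    [Module k E] [IsScalarTower k A E]
    (G : A →ₗ[k] A →ₗ[k] E →ₗ[k] E) :
    (∃ ρ : A →ₗ[k] E →ₗ[k] E,
      ∀ (a b : A) (e : E), a • ρ b e - ρ (a * b) e + ρ a (b • e) = G a b e) ↔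
    ((∀ x ∈ I, ∀ y ∈ I, ∀ e : E, G x y e = G y x e) ∧
      (∀ (a b c : A) (e : E),
        a • G b c e - G (a * b) c e + G a (b * c) e - G a b (c • e) = 0)) := by
  have hIE : ∀ x ∈ I, ∀ e : E, x • e = 0 := by
    intro x hx e
    rw [← algebraMap_smul (A ⧸ I) x e]
    have : algebraMap A (A ⧸ I) x = 0 := Ideal.Quotient.eq_zero_iff_mem.mpr hx
    rw [this, zero_smul]
  have : SMulCommClass k A E := IsScalarTower.to_smulCommClass
  have : IsNoetherianRing A := Algebra.FiniteType.isNoetherianRing k A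
  constructor
  · rintro ⟨ρ, hρ⟩
    refine ⟨fun x hx y hy e => ?_, fun a b c e => ?_⟩
    · rw [← hρ, ← hρ, hIE x hx, hIE y hy, hIE x hx, hIE y hy, mul_comm]
      simp
    · simp only [← hρ, smul_add, smul_sub, mul_assoc, mul_smul]
      abel
  · rintro ⟨hsym, hc⟩
    -- restrict to `A × I`
    let g : A →+ I →+ (E →ₗ[k] E) :=
      AddMonoidHom.mk' (fun a => AddMonoidHom.mk' (fun c => G a c) (by intro c d; simp))
        (by intro a b; ext c e; simp)
    have hg : ∀ a c, g a c = G a (c : A) := fun a c => rfl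
    let C : HKRAux.Cocyc A I (E →ₗ[k] E) :=
      { g := g
        one := by
          intro c
          ext e
          have := hc 1 1 c e
          rw [hIE c c.2] at this
          simpa [hg] using this
        cocycle := by
          intro a b c
          ext e
          have := hc a b c e
          rw [hIE c c.2, map_zero, sub_zero] at this
          rw [LinearMap.add_apply, LinearMap.smul_apply, hg, hg, hg]
          change G (a * b) c e = a • G b c e + G a (b * c) e
          rw [eq_comm, ← sub_eq_zero, ← this]
          abel }
    obtain ⟨ρ0, hρ0⟩ := HKRAux.twist_split (k := k) C
      (fun x hx φ => LinearMap.ext fun e => hIE x hx (φ e))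
      (fun x y => LinearMap.ext fun e => hsym x x.2 y y.2 e)
    let ρ1 : (I.restrictScalars k : Submodule k A) →ₗ[k] (E →ₗ[k] E) :=
      { toFun := fun c => ρ0 c
        map_add' := fun c d => map_add ρ0 c d
        map_smul' := by
          intro t c
          have h1 := hρ0 (algebraMap k A t) c
          have h2 : C.g (algebraMap k A t) c = 0 := by
            have h3 := C.one c
            change G 1 (c : A) = 0 at h3
            change G (algebraMap k A t) (c : A) = 0
            rw [Algebra.algebraMap_eq_smul_one, map_smul, LinearMap.smul_apply, h3, smul_zero]
          rw [h2, sub_eq_zero] at h1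
          have h4 : (algebraMap k A t) • (show I from c) = (show I from t • c) := by
            apply Subtype.ext
            exact (Algebra.smul_def t (c : A)).symm
          rw [h4] at h1
          rw [RingHom.id_apply]
          change ρ0 (show I from t • c) = _
          rw [← h1]
          ext e
          simp }
    obtain ⟨ρ2, hρ2⟩ := LinearMap.exists_extend ρ1
    have hρ2' : ∀ c (hc : c ∈ I), ρ2 c = ρ0 ⟨c, hc⟩ := fun c hc =>
      LinearMap.congr_fun hρ2 ⟨c, hc⟩
    -- the coboundary of ρ2
    let lA : A →ₗ[k] Module.End k E := (Algebra.lsmul k k E : A →ₐ[k] Module.End k E).toLinearMap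
    have hlA : ∀ a e, lA a e = a • e := fun a e => rfl
    let dρ : A →ₗ[k] A →ₗ[k] E →ₗ[k] E :=
      LinearMap.mk₂ k (fun a b => a • ρ2 b - ρ2 (a * b) + ρ2 a ∘ₗ lA b)
        (by
          intro a a' b; ext e
          simp only [LinearMap.add_apply, LinearMap.sub_apply, LinearMap.smul_apply,
            LinearMap.comp_apply, hlA, add_smul, add_mul, map_add]
          abel)
        (by
          intro t a b; ext e
          simp only [LinearMap.add_apply, LinearMap.sub_apply, LinearMap.smul_apply,
            LinearMap.comp_apply, hlA, smul_assoc, smul_mul_assoc, map_smul, smul_add, smul_sub])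
        (by
          intro a b b'; ext e
          simp only [LinearMap.add_apply, LinearMap.sub_apply, LinearMap.smul_apply,
            LinearMap.comp_apply, hlA, add_smul, mul_add, map_add, smul_add]
          abel)
        (by
          intro t a b; ext e
          simp only [LinearMap.add_apply, LinearMap.sub_apply, LinearMap.smul_apply,
            LinearMap.comp_apply, hlA, smul_assoc, mul_smul_comm, map_smul, smul_add, smul_sub]
          rw [smul_comm a t])
    have hdρ : ∀ a b e, dρ a b e = a • ρ2 b e - ρ2 (a * b) e + ρ2 a (b • e) := fun a b e => rfl
    obtain ⟨ρ3, hρ3⟩ := HKRAux.coboundary_of_kills I (G - dρ) (by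
      intro a c hcI
      ext e
      have h1 := LinearMap.congr_fun (hρ0 a ⟨c, hcI⟩) e
      change a • ρ0 ⟨c, hcI⟩ e - ρ0 ⟨a * c, I.mul_mem_left a hcI⟩ e = G a c e at h1
      rw [← hρ2', ← hρ2'] at h1
      simp only [LinearMap.sub_apply, hdρ, ← h1, hIE c hcI, map_zero]
      simp) (by
      intro a b c e
      have h1 := hc a b c e
      have h2 : a • dρ b c e - dρ (a * b) c e + dρ a (b * c) e - dρ a b (c • e) = 0 := by
        simp only [hdρ, smul_add, smul_sub, mul_assoc, mul_smul]
        abel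
      simp only [LinearMap.sub_apply, smul_sub]
      rw [← sub_zero (0 : E)]
      nth_rewrite 1 [← h1]
      rw [← h2]
      abel)
    refine ⟨ρ2 + ρ3, fun a b e => ?_⟩
    have h3 := hρ3 a b e
    simp only [LinearMap.sub_apply, hdρ] at h3
    simp only [LinearMap.add_apply, smul_add]
    rw [eq_comm, ← sub_eq_zero] at h3 ⊢
    rw [← h3]
    abel
end

section
/- Let k be a field of characteristic zero, A a smooth commutative k-algebra (formally smooth and of finite presentation over k), I an ideal with B = A/I smooth over k, and E a finitely generated projective B-module viewed as an A-module with I·E = 0. Let π : A × A → A be k-bilinear and let α₁ : A × E → E be a k-bilinear map satisfying a·α₁(b,e) − α₁(ab,e) + α₁(a,b·e) = π(a,b)·e. Let φ : E → E be an A-linear map. Then there exists a k-linear map η : E → E satisfying η(a·e) − a·η(e) = α₁(a,φ(e)) − φ(α₁(a,e)) for all a ∈ A, e ∈ E, if and only if α₁(x,φ(e)) = φ(α₁(x,e)) for all x ∈ I and e ∈ E. -/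
universe u v

/-- In the smooth affine setting, for an A-linear φ : E → E and a solution
α₁ of the first order module equation (A.5), there exists a k-linear η : E → E with
η(a·e) − a·η(e) = α₁(a,φ(e)) − φ(α₁(a,e)) if and only if φ commutes with the induced
connection: α₁(x,φ(e)) = φ(α₁(x,e)) for all x ∈ I. -/
theorem automorphism_extends_iff_commutes_with_connection
    (k : Type u) [Field k] [CharZero k]
    (A : Type u) [CommRing A] [Algebra k A]
    [Algebra.FormallySmooth k A] [Algebra.FinitePresentation k A]
    (I : Ideal A)
    [Algebra.FormallySmooth k (A ⧸ I)] [Algebra.FinitePresentation k (A ⧸ I)]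
    (E : Type v) [AddCommGroup E] [Module (A ⧸ I) E]
    [Module.Finite (A ⧸ I) E] [Module.Projective (A ⧸ I) E]
    [Module A E] [IsScalarTower A (A ⧸ I) E]
    [Module k E] [IsScalarTower k A E]
    (π : A →ₗ[k] A →ₗ[k] A)
    (α₁ : A →ₗ[k] E →ₗ[k] E)
    (h1 : ∀ (a b : A) (e : E),
      a • α₁ b e - α₁ (a * b) e + α₁ a (b • e) = π a b • e)
    (φ : E →ₗ[A] E) :
    (∃ η : E →ₗ[k] E,
      ∀ (a : A) (e : E), η (a • e) - a • η e = α₁ a (φ e) - φ (α₁ a e)) ↔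
    (∀ x ∈ I, ∀ e : E, α₁ x (φ e) = φ (α₁ x e)) := by
  constructor
  · rintro ⟨η, hη⟩ x hx e
    have hz : ∀ e : E, x • e = 0 := fun e => by
      rw [← one_smul (A ⧸ I) e, ← smul_assoc]
      have : x • (1 : A ⧸ I) = 0 := by
        rw [Algebra.smul_def, mul_one]
        exact Ideal.Quotient.eq_zero_iff_mem.mpr hx
      rw [this, zero_smul]
    have h := hη x e
    rw [hz, hz, map_zero, sub_zero] at h
    exact (sub_eq_zero.mp h.symm)
  · intro hI
    -- the Hochschild cocycle
    let ψ : E →ₗ[k] A →ₗ[k] E :=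
      α₁.flip ∘ₗ (φ.restrictScalars k) - (α₁.compr₂ (φ.restrictScalars k)).flip
    have hψ : ∀ a e, ψ e a = α₁ a (φ e) - φ (α₁ a e) := fun a e => rfl
    have hcoc : ∀ a b e, ψ e (a * b) = a • ψ e b + ψ (b • e) a := by
      intro a b e
      have e1 := h1 a b (φ e)
      have e2 := congrArg φ (h1 a b e)
      simp only [map_add, map_sub, map_smul] at e2
      rw [← e1] at e2
      simp only [hψ, map_smul, smul_sub]
      rw [← sub_eq_zero] at e2 ⊢
      rw [← e2]
      abel
    have hψI : ∀ a b e, Ideal.Quotient.mk I a = Ideal.Quotient.mk I b → ψ e a = ψ e b := by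
      intro a b e hab
      rw [← sub_eq_zero, ← map_sub, hψ, hI _ (Ideal.Quotient.eq.mp hab), sub_self]
    obtain ⟨σ, hσ⟩ := LinearMap.exists_rightInverse_of_surjective
      (Ideal.Quotient.mkₐ k I).toLinearMap
      (LinearMap.range_eq_top.mpr (Ideal.Quotient.mkₐ_surjective k I))
    have hσ' : ∀ b, Ideal.Quotient.mk I (σ b) = b := fun b => LinearMap.congr_fun hσ b
    obtain ⟨s, hs⟩ := (Module.projective_def (R := A ⧸ I) (P := E)).mp inferInstance
    let sk : E →ₗ[k] (E →₀ A ⧸ I) := (s.restrictScalars A).restrictScalars k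
    refine ⟨(Finsupp.lsum k (fun i : E => (ψ i) ∘ₗ σ)) ∘ₗ sk, ?_⟩
    intro a e
    have key : ∀ f : E →₀ A ⧸ I,
        Finsupp.lsum k (fun i : E => (ψ i) ∘ₗ σ) (a • f)
          = a • Finsupp.lsum k (fun i : E => (ψ i) ∘ₗ σ) f
            + ψ (Finsupp.linearCombination (A ⧸ I) id f) a := by
      intro f
      induction f using Finsupp.induction_linear with
      | zero => simp
      | add f g hf hg =>
        rw [smul_add, map_add, hf, hg, map_add, map_add, map_add, smul_add, LinearMap.add_apply]
        abel
      | single i b =>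
        rw [Finsupp.smul_single, Finsupp.lsum_single, Finsupp.lsum_single,
          Finsupp.linearCombination_single]
        simp only [LinearMap.comp_apply, id]
        have hb : b • i = σ b • i := by
          conv_lhs => rw [← hσ' b]
          exact algebraMap_smul (A ⧸ I) (σ b) i
        rw [hb, ← hcoc]
        apply hψI
        rw [hσ', map_mul, hσ', Algebra.smul_def]
        rfl
    have hsk : sk (a • e) = a • sk e := (s.restrictScalars A).map_smul a e
    simp only [LinearMap.comp_apply]
    rw [hsk, key, add_sub_cancel_left, ← hψ]
    congr 2
    exact hs e
end
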